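/- Let 1 ≤ j < k be integers and ε > 0. There exist β ∈ (0,1) and t_0 such that for every t ≥ t_0 the following holds, where T = t(k-1)+1, m̃ = t^{100k} and m = T·m̃. Let G' be a k-graph with |V(G')| = m and δ_j(G') ≥ (δ_j^k(1)+ε/4)·m^{k-j}, let B be a (2-uniform) graph with V(B) = V(G') and Δ(B) ≤ 2tk², let {u^i_a,u^i_b} (i ∈ [m̃]) be pairwise disjoint pairs of vertices with union R, and let W_0 = W_{m̃} = ∅ and W_1,…,W_{m̃-1} be pairwise disjoint (k-2)-element subsets of V(G') \ R such that for each i ∈ [m̃] the only possible edge of B inside {u^i_a,u^i_b} ∪ W_{i-1} ∪ W_i is {u^i_a,u^i_b}. Set V' = V(G') \ (R ∪ W_1 ∪ … ∪ W_{m̃-1}). For a partition V' = U_1 ∪ … ∪ U_{m̃} and i ∈ [m̃], write U_i^+ = U_i ∪ {u^i_a,u^i_b} ∪ W_{i-1} ∪ W_i; call U_i bad if B[U_i^+] contains an edge other than {u^i_a,u^i_b}, and very bad if there is no single vertex u ∈ U_i incident to all edges of B[U_i^+] other than {u^i_a,u^i_b}. Then there exists a partition V' = U_1 ∪ … ∪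 U_{m̃} such that: (A) (t-1)(k-1) - βt ≤ |U_i| ≤ (t-1)(k-1) + βt for all i ∈ [m̃]; (B) deg_{G'}(S; U_i^+) ≥ (δ_j^k(1)+3ε/16)·|U_i^+|^{k-j} for every j-element set S ⊆ V' and every i ∈ [m̃]; (C) no U_i is very bad; and (D) at most t³k³ of the sets U_i are bad. -/

import Mathlib

open Finset

open scoped Classical

noncomputable section

/-- A `k`-uniform hypergraph with vertices drawn from `ℕ`. -/
structure HGraph (k : ℕ) where
  verts : Finset ℕ
  edges : Finset (Finset ℕ)
  edge_sub : ∀ e ∈ edges, e ⊆ verts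
  edge_card : ∀ e ∈ edges, e.card = k

namespace HGraph

variable {k : ℕ}

/-- The number of edges of `G` containing the vertex set `S`. -/
def degOn (G : HGraph k) (S : Finset ℕ) : ℕ :=
  (G.edges.filter fun e => S ⊆ e).card

/-- The relative degree `deg_G(S; W)`: edges containing `S` whose other vertices lie in `W`. -/
def degIn (G : HGraph k) (S W : Finset ℕ) : ℕ :=
  (G.edges.filter fun e => S ⊆ e ∧ e \ S ⊆ W).card

/-- The edge set of the induced subhypergraph `G[U]`. -/
def inducedEdges (G : HGraph k) (U : Finset ℕ) : Finset (Finset ℕ) :=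
  G.edges.filter fun e => e ⊆ U

/-- `δ_j(G) ≥ d`. -/
def MinDegGe (G : HGraph k) (j : ℕ) (d : ℝ) : Prop :=
  ∀ T ⊆ G.verts, T.card = j → d ≤ (G.degOn T : ℝ)

/-- `δ_j(G[U]) ≥ d`. -/
def MinDegOnGe (G : HGraph k) (j : ℕ) (U : Finset ℕ) (d : ℝ) : Prop :=
  ∀ T ⊆ U, T.card = j → d ≤ (((G.inducedEdges U).filter fun e => T ⊆ e).card : ℝ)

end HGraph

/-- A colouring is rainbow on a set of edges if distinct edges receive distinct colours. -/
def RainbowEdges (χ : Finset ℕ → ℕ) (E : Finset (Finset ℕ)) : Prop :=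
  ∀ e ∈ E, ∀ f ∈ E, χ e = χ f → e = f

/-- `χ` is globally `b`-bounded on `G`: every colour class has at most `b` edges. -/
def GloballyBounded {k : ℕ} (G : HGraph k) (χ : Finset ℕ → ℕ) (b : ℝ) : Prop :=
  ∀ c : ℕ, ((G.edges.filter fun e => χ e = c).card : ℝ) ≤ b

/-- The number of edges of a loose Hamilton cycle of `G`. -/
def numE {k : ℕ} (G : HGraph k) : ℕ := G.verts.card / (k - 1)

/-- A loose Hamilton cycle in `G`, recorded by a cyclic ordering of the vertices:
`σ` enumerates the vertices, and the `i`-th edge consists of the `k` consecutive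
vertices starting at position `i(k-1)`, so that consecutive edges share exactly one
vertex (when `(k-1) ∣ |V(G)|`). -/
structure LooseHamCycle (k : ℕ) (G : HGraph k) where
  σ : ℕ → ℕ
  injOn : Set.InjOn σ (Set.Iio G.verts.card)
  image_eq : (Finset.range G.verts.card).image σ = G.verts
  edges_mem : ∀ i < numE G,
    (Finset.range k).image (fun r => σ ((i * (k - 1) + r) % G.verts.card)) ∈ G.edges

namespace LooseHamCycle

variable {k : ℕ} {G : HGraph k}

/-- The `i`-th edge of the cycle. -/
def cedge (H : LooseHamCycle k G) (i : ℕ) : Finset ℕ :=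
  (Finset.range k).image fun r => H.σ ((i * (k - 1) + r) % G.verts.card)

/-- The edge set of the cycle. -/
def cedges (H : LooseHamCycle k G) : Finset (Finset ℕ) :=
  (Finset.range (numE G)).image H.cedge

/-- The edge set of the increasing loose path of length `t` starting at edge `i`. -/
def pEdges (H : LooseHamCycle k G) (i t : ℕ) : Finset (Finset ℕ) :=
  (Finset.range t).image fun r => H.cedge ((i + r) % numE G)

/-- The vertex set of the increasing loose path of length `t` starting at edge `i`. -/
def pVerts (H : LooseHamCycle k G) (i t : ℕ) : Finset ℕ :=
  (Finset.range (t * (k - 1) + 1)).image fun r => H.σ ((i * (k - 1) + r) % G.verts.card)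

/-- The first endvertex of the increasing loose path starting at edge `i`. -/
def pEndA (H : LooseHamCycle k G) (i : ℕ) : ℕ := H.σ ((i * (k - 1)) % G.verts.card)

/-- The last endvertex of the increasing loose path of length `t` starting at edge `i`. -/
def pEndB (H : LooseHamCycle k G) (i t : ℕ) : ℕ :=
  H.σ ((i * (k - 1) + t * (k - 1)) % G.verts.card)

/-- The endvertex pair of the increasing loose path of length `t` starting at edge `i`. -/
def pEnds (H : LooseHamCycle k G) (i t : ℕ) : Finset ℕ := {H.pEndA i, H.pEndB i t}

end LooseHamCycle

/-- The loose Hamilton cycle threshold `δ_j^k(1)`: the least `δ ≥ 0` such that for every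
`ε > 0` all sufficiently large `k`-graphs `G` (with `(k-1) ∣ n`) satisfying
`δ_j(G) ≥ (δ+ε)n^{k-j}` contain a loose Hamilton cycle. -/
noncomputable def looseHamThreshold (j k : ℕ) : ℝ :=
  sInf {δ : ℝ | 0 ≤ δ ∧ ∀ ε : ℝ, 0 < ε → ∃ n₀ : ℕ, ∀ n : ℕ, n₀ ≤ n → (k - 1) ∣ n →
    ∀ G : HGraph k, G.verts.card = n →
      G.MinDegGe j ((δ + ε) * (n : ℝ) ^ (k - j)) → Nonempty (LooseHamCycle k G)}

/-- `T = t(k-1)+1`. -/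
def TOf (k t : ℕ) : ℕ := t * (k - 1) + 1
/-- `m̃ = t^{100k}`. -/
def mtOf (k t : ℕ) : ℕ := t ^ (100 * k)
/-- `m = T·m̃`. -/
def mOf (k t : ℕ) : ℕ := TOf k t * mtOf k t
/-- `M = T·m`. -/
def MOf (k t : ℕ) : ℕ := TOf k t * mOf k t

section Splittings

variable {k : ℕ} {G : HGraph k}

/-- `I` is the index set of a `t`-balanced splitting of `H`: a collection of
pairwise vertex-disjoint increasing loose paths of length `t` of `H`. -/
def IsSplitting (H : LooseHamCycle k G) (t : ℕ) (I : Finset ℕ) : Prop :=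
  (∀ i ∈ I, i < numE G) ∧
    ∀ i ∈ I, ∀ i' ∈ I, i ≠ i' → Disjoint (H.pVerts i t) (H.pVerts i' t)

/-- `V(𝒫)` for the splitting indexed by `I`. -/
def splitVerts (H : LooseHamCycle k G) (t : ℕ) (I : Finset ℕ) : Finset ℕ :=
  I.biUnion fun i => H.pVerts i t

/-- `V^E(𝒫)` for the splitting indexed by `I`. -/
def splitEnds (H : LooseHamCycle k G) (t : ℕ) (I : Finset ℕ) : Finset ℕ :=
  I.biUnion fun i => H.pEnds i t

/-- `V^I(𝒫)` for the splitting indexed by `I`. -/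
def splitInt (H : LooseHamCycle k G) (t : ℕ) (I : Finset ℕ) : Finset ℕ :=
  splitVerts H t I \ splitEnds H t I

/-- A vertex set `S` is transverse with respect to the splitting indexed by `I`. -/
def Transverse (H : LooseHamCycle k G) (t : ℕ) (I : Finset ℕ) (S : Finset ℕ) : Prop :=
  ∀ i ∈ I, (S ∩ H.pVerts i t).card ≤ 1

/-- The splitting indexed by `I` is suitable for the path `P₀` (the increasing path
of length `t` starting at edge `i₀`). -/
def Suitable (χ : Finset ℕ → ℕ) (ε : ℝ) (m : ℕ) (H : LooseHamCycle k G)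
    (t : ℕ) (I : Finset ℕ) (i₀ : ℕ) : Prop :=
  (∀ S ⊆ splitVerts H t I \ H.pVerts i₀ t, S.card = k - 1 → Transverse H t I S →
    ((((G.inducedEdges (splitVerts H t I)).filter
        fun e => S ⊆ e ∧ ∃ f ∈ H.cedges, χ f = χ e).card : ℝ) ≤ ε * (m : ℝ) / 4)) ∧
  (∀ X ⊆ splitVerts H t I \ H.pVerts i₀ t, Transverse H t I X →
    ∀ e ∈ G.inducedEdges X, ∀ f ∈ G.inducedEdges X,
      χ e = χ f → (e ∩ f).card = 1 → False) ∧
  (∀ e ∈ G.inducedEdges (splitVerts H t I \ H.pVerts i₀ t),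
    ∀ f ∈ G.inducedEdges (splitVerts H t I \ H.pVerts i₀ t),
      χ e = χ f → Disjoint e f → Transverse H t I e → Transverse H t I f →
      ∃ i ∈ I, ∃ i' ∈ I, i ≠ i' ∧
        (H.pVerts i t ∩ e).Nonempty ∧ (H.pVerts i t ∩ f).Nonempty ∧
        (H.pVerts i' t ∩ e).Nonempty ∧ (H.pVerts i' t ∩ f).Nonempty)

/-- The cyclic successor of `i` within the index set `I`. -/
def nextIdx (I : Finset ℕ) (i : ℕ) : ℕ :=
  if h : (I.filter fun i' => i < i').Nonempty then (I.filter fun i' => i < i').min' h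
  else if h2 : I.Nonempty then I.min' h2 else 0

/-- `M` is a rerouting of the splitting indexed by `I`: a partition of `V^E(𝒫)` into
pairs such that identifying the two vertices of each pair connects the paths of
`H[V(G) ∖ V^I(𝒫)]` into a single loose cycle (the arcs of `H` between consecutive
paths of the splitting, together with the identified pairs, form a connected graph). -/
def IsRerouting (H : LooseHamCycle k G) (t : ℕ) (I : Finset ℕ)
    (M : Finset (Finset ℕ)) : Prop :=
  (∀ p ∈ M, p.card = 2 ∧ p ⊆ splitEnds H t I) ∧
  (∀ p ∈ M, ∀ q ∈ M, p ≠ q → Disjoint p q) ∧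
  M.biUnion id = splitEnds H t I ∧
  ∀ u ∈ splitEnds H t I, ∀ v ∈ splitEnds H t I,
    Relation.ReflTransGen
      (fun a b => ({a, b} : Finset ℕ) ∈ M ∨
        ∃ i ∈ I, ({a, b} : Finset ℕ) = {H.pEndB i t, H.pEndA (nextIdx I i)}) u v

/-- `X` (indexed over `Finset.range T`) is a viable partition of `V(𝒫)` for the
`t`-balanced splitting indexed by `I`. -/
def IsViablePartition (j : ℕ) (ε : ℝ) (t : ℕ) (H : LooseHamCycle k G)
    (I : Finset ℕ) (X : ℕ → Finset ℕ) : Prop :=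
  (Finset.range (TOf k t)).biUnion X = splitVerts H t I ∧
  (∀ h ∈ Finset.range (TOf k t), ∀ h' ∈ Finset.range (TOf k t), h ≠ h' →
    Disjoint (X h) (X h')) ∧
  (∀ h ∈ Finset.range (TOf k t), Transverse H t I (X h)) ∧
  (∃ M : Finset (Finset ℕ), IsRerouting H t I M ∧
    ∀ h ∈ Finset.range (TOf k t), (M.filter fun p => p ⊆ X h).card = mtOf k t) ∧
  ∀ h ∈ Finset.range (TOf k t),
    G.MinDegOnGe j (X h) ((looseHamThreshold j k + ε / 2) * (mOf k t : ℝ) ^ (k - j))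

/-- The vertex set spanned by a set of edges. -/
def eVerts (E : Finset (Finset ℕ)) : Finset ℕ := E.biUnion id

/-- `(𝒫, H', 𝒫')` is a `(P₀,H)`-switching of size `m`, where `𝒫` is the `t`-balanced
splitting of `H` indexed by `I` containing `P₀` (the increasing path of length `t`
starting at edge `i₀`), and `𝒫'` is the `2t`-bounded splitting of `H'` whose paths are
recorded in `Q` as pairs (edge set, endvertex pair). -/
def IsSwitching (t m : ℕ) (H : LooseHamCycle k G) (i₀ : ℕ) (I : Finset ℕ)
    (H' : LooseHamCycle k G) (Q : Finset (Finset (Finset ℕ) × Finset ℕ)) : Prop :=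
  IsSplitting H t I ∧ I.card = m ∧ i₀ ∈ I ∧
  Q.card = m ∧
  (∀ q ∈ Q, ∃ i ℓ : ℕ, i < numE G ∧ 1 ≤ ℓ ∧ ℓ ≤ 2 * t ∧
    q.1 = H'.pEdges i ℓ ∧ q.2 = H'.pEnds i ℓ) ∧
  (∀ q ∈ Q, ∀ q' ∈ Q, q ≠ q' → Disjoint (eVerts q.1) (eVerts q'.1)) ∧
  splitInt H t I = (Q.biUnion fun q => eVerts q.1) \ (Q.biUnion fun q => q.2) ∧
  H.cedges.filter (fun e => e ⊆ G.verts \ splitInt H t I) =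
    H'.cedges.filter (fun e =>
      e ⊆ G.verts \ ((Q.biUnion fun q => eVerts q.1) \ (Q.biUnion fun q => q.2))) ∧
  ∀ q ∈ Q, (H.pVerts i₀ t ∩ eVerts q.1).card ≤ 1

/-- A feasible `(P₀,H)`-switching: additionally `F' = H'[V(𝒫') ∖ V(P₀)]` is rainbow and
no edge of `F'` shares a colour with an edge of `H[V(G) ∖ V^I(𝒫)]`. -/
def IsFeasibleSwitching (χ : Finset ℕ → ℕ) (t m : ℕ) (H : LooseHamCycle k G)
    (i₀ : ℕ) (I : Finset ℕ) (H' : LooseHamCycle k G)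
    (Q : Finset (Finset (Finset ℕ) × Finset ℕ)) : Prop :=
  IsSwitching t m H i₀ I H' Q ∧
  RainbowEdges χ (H'.cedges.filter fun e =>
    e ⊆ (Q.biUnion fun q => eVerts q.1) \ H.pVerts i₀ t) ∧
  ∀ e ∈ H'.cedges.filter (fun e =>
      e ⊆ (Q.biUnion fun q => eVerts q.1) \ H.pVerts i₀ t),
    ∀ f ∈ H.cedges.filter (fun f => f ⊆ G.verts \ splitInt H t I), χ e ≠ χ f

/-- Two vertices are close (with respect to `H` and `t`) if they lie in edges of `H`
both contained in a loose path of `H` of length at most `2t+1`. -/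
def Close (H : LooseHamCycle k G) (t : ℕ) (u v : ℕ) : Prop :=
  ∃ i < numE G, ∃ i' < numE G, u ∈ H.cedge i ∧ v ∈ H.cedge i' ∧
    ∃ d ≤ 2 * t, (i + d) % numE G = i' ∨ (i' + d) % numE G = i

/-- A vertex set is spread if no two of its vertices are close. -/
def SpreadSet (H : LooseHamCycle k G) (t : ℕ) (S : Finset ℕ) : Prop :=
  ∀ u ∈ S, ∀ v ∈ S, u ≠ v → ¬ Close H t u v

/-- A vertex set is almost spread if exactly one pair of its vertices is close. -/
def AlmostSpreadSet (H : LooseHamCycle k G) (t : ℕ) (S : Finset ℕ) : Prop :=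
  ∃ u ∈ S, ∃ v ∈ S, u ≠ v ∧ Close H t u v ∧
    ∀ u' ∈ S, ∀ v' ∈ S, u' ≠ v' → Close H t u' v' → ({u', v'} : Finset ℕ) = {u, v}

end Splittings

/-- The probability that a `p`-random subset of `Finset.range N` (each element included
independently with probability `p`) satisfies `A`. -/
noncomputable def probOver (N : ℕ) (p : ℝ) (A : Finset ℕ → Prop) : ℝ :=
  ∑ S ∈ (Finset.range N).powerset,
    if A S then p ^ S.card * (1 - p) ^ (N - S.card) else 0

/-- A loose path of length `t` in `G`, recorded by an ordering of its vertices. -/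
structure LoosePath (k t : ℕ) (G : HGraph k) where
  σ : ℕ → ℕ
  injOn : Set.InjOn σ (Set.Iio (t * (k - 1) + 1))
  mem_verts : ∀ r < t * (k - 1) + 1, σ r ∈ G.verts
  edges_mem : ∀ i < t, (Finset.range k).image (fun r => σ (i * (k - 1) + r)) ∈ G.edges

namespace LoosePath

variable {k t : ℕ} {G : HGraph k}

/-- The vertex set of a loose path. -/
def verts (P : LoosePath k t G) : Finset ℕ := (Finset.range (t * (k - 1) + 1)).image P.σ

/-- The edge set of a loose path. -/
def edgeSet (P : LoosePath k t G) : Finset (Finset ℕ) :=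
  (Finset.range t).image fun i => (Finset.range k).image fun r => P.σ (i * (k - 1) + r)

/-- The first endvertex of a loose path. -/
def endA (P : LoosePath k t G) : ℕ := P.σ 0

/-- The last endvertex of a loose path. -/
def endB (P : LoosePath k t G) : ℕ := P.σ (t * (k - 1))

end LoosePath


/-- Average over a finite product. -/
def gE {n : ℕ} {α : Type} [Fintype α] (f : (Fin n → α) → ℝ) : ℝ :=
  (∑ ω, f ω) / (Fintype.card α : ℝ) ^ n

/-- Probability over a finite product. -/
def gP {n : ℕ} {α : Type} [Fintype α] (E : (Fin n → α) → Prop) : ℝ :=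
  gE fun ω => if E ω then 1 else 0

theorem gE_mono {n : ℕ} {α : Type} [Fintype α] {f f' : (Fin n → α) → ℝ}
    (h : ∀ ω, f ω ≤ f' ω) : gE f ≤ gE f' := by
  unfold gE
  gcongr with ω _
  exact h ω

theorem gE_sum {n : ℕ} {α ι : Type} [Fintype α] (s : Finset ι) (f : ι → (Fin n → α) → ℝ) :
    gE (fun ω => ∑ x ∈ s, f x ω) = ∑ x ∈ s, gE (f x) := by
  unfold gE
  rw [Finset.sum_comm, Finset.sum_div]

theorem gE_const_mul {n : ℕ} {α : Type} [Fintype α] (c : ℝ) (f : (Fin n → α) → ℝ) :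
    gE (fun ω => c * f ω) = c * gE f := by
  unfold gE
  rw [← Finset.mul_sum, mul_div_assoc]

theorem gE_const {n : ℕ} {α : Type} [Fintype α] [Nonempty α] (c : ℝ) :
    gE (fun _ : Fin n → α => c) = c := by
  unfold gE
  have : (Fintype.card α : ℝ) ≠ 0 := by
    exact_mod_cast Fintype.card_ne_zero
  simp

theorem gE_succ {n : ℕ} {α : Type} [Fintype α] (f : (Fin (n+1) → α) → ℝ) :
    gE f = (∑ a, gE (fun ω : Fin n → α => f (Fin.cons a ω))) / (Fintype.card α : ℝ) := by
  unfold gE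
  rw [← Finset.sum_div, div_div, ← pow_succ]
  congr 1
  rw [← (Fin.consEquiv (fun _ : Fin (n+1) => α)).sum_comp, Fintype.sum_prod_type]
  rfl

theorem gP_mono {n : ℕ} {α : Type} [Fintype α] {E E' : (Fin n → α) → Prop}
    (h : ∀ ω, E ω → E' ω) : gP E ≤ gP E' := by
  apply gE_mono
  intro ω
  have := h ω
  split_ifs <;> simp_all

theorem gP_union {n : ℕ} {α ι : Type} [Fintype α] (s : Finset ι)
    (E : ι → (Fin n → α) → Prop) :
    gP (fun ω => ∃ x ∈ s, E x ω) ≤ ∑ x ∈ s, gP (E x) := by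
  unfold gP
  rw [← gE_sum]
  apply gE_mono
  intro ω
  split_ifs with h
  · obtain ⟨x, hx, hE⟩ := h
    calc (1:ℝ) = if E x ω then 1 else 0 := by simp [hE]
      _ ≤ _ := Finset.single_le_sum (f := fun x => if E x ω then (1:ℝ) else 0)
        (fun y _ => by positivity) hx
  · positivity

theorem gE_add {n : ℕ} {α : Type} [Fintype α] (f f' : (Fin n → α) → ℝ) :
    gE (fun ω => f ω + f' ω) = gE f + gE f' := by
  unfold gE
  rw [Finset.sum_add_distrib, add_div]

theorem gP_or {n : ℕ} {α : Type} [Fintype α] (E F : (Fin n → α) → Prop) :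
    gP (fun ω => E ω ∨ F ω) ≤ gP E + gP F := by
  unfold gP
  rw [← gE_add]
  apply gE_mono
  intro ω
  by_cases h : E ω <;> by_cases h' : F ω <;> simp [h, h']

theorem gP_exists_not {n : ℕ} {α : Type} [Fintype α] [Nonempty α] (E : (Fin n → α) → Prop)
    (h : gP E < 1) : ∃ ω, ¬ E ω := by
  by_contra hc
  push Not at hc
  have : gP E = gE (fun _ : Fin n → α => (1:ℝ)) := by
    unfold gP
    congr 1
    funext ω
    simp [hc ω]
  rw [gE_const] at this
  linarith

theorem gP_markov {n : ℕ} {α : Type} [Fintype α] (X : (Fin n → α) → ℝ) (hX : ∀ ω, 0 ≤ X ω)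
    (a : ℝ) (ha : 0 < a) : gP (fun ω => a ≤ X ω) ≤ gE X / a := by
  rw [div_eq_inv_mul, ← gE_const_mul]
  apply gE_mono
  intro ω
  have := hX ω
  split_ifs with h
  · rw [inv_mul_eq_div, le_div_iff₀ ha]; linarith
  · positivity

theorem exp_le_cosh_sinh (c l x : ℝ) (hc : 0 < c) (hx : |x| ≤ c) :
    Real.exp (l * x) ≤ Real.cosh (l * c) + x * (Real.sinh (l * c) / c) := by
  have h := convexOn_exp.2 (Set.mem_univ (-(l*c))) (Set.mem_univ (l*c))
    (show 0 ≤ (c - x) / (2*c) by have := abs_le.1 hx; apply div_nonneg <;> linarith)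
    (show 0 ≤ (c + x) / (2*c) by have := abs_le.1 hx; apply div_nonneg <;> linarith) (by field_simp; ring)
  simp only [smul_eq_mul] at h
  have e1 : (c - x) / (2*c) * -(l*c) + (c + x) / (2*c) * (l*c) = l * x := by
    field_simp; ring
  rw [e1] at h
  refine h.trans (le_of_eq ?_)
  rw [Real.cosh_eq, Real.sinh_eq]
  field_simp
  ring

theorem avg_exp {α : Type} [Fintype α] [Nonempty α] (h : α → ℝ) (c l : ℝ) (hc : 0 < c)
    (hd : ∀ a b, |h a - h b| ≤ c) :
    (∑ a, Real.exp (l * (h a - (∑ b, h b) / Fintype.card α))) / Fintype.card α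
      ≤ Real.exp (l ^ 2 * c ^ 2 / 2) := by
  set μ := (∑ b, h b) / (Fintype.card α : ℝ) with hμ
  have hN : (0:ℝ) < Fintype.card α := by exact_mod_cast Fintype.card_pos
  have hx : ∀ a, |h a - μ| ≤ c := by
    intro a
    have : h a - μ = (∑ b, (h a - h b)) / (Fintype.card α : ℝ) := by
      rw [Finset.sum_sub_distrib, hμ]; simp; field_simp
    rw [this, abs_div, abs_of_pos hN, div_le_iff₀ hN]
    calc _ ≤ ∑ b, |h a - h b| := Finset.abs_sum_le_sum_abs _ _
      _ ≤ ∑ b : α, c := Finset.sum_le_sum fun b _ => hd a b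
      _ = _ := by simp [mul_comm]
  have hz : ∑ a, (h a - μ) = 0 := by
    rw [Finset.sum_sub_distrib, hμ]; simp; field_simp; simp
  rw [div_le_iff₀ hN]
  calc _ ≤ ∑ a, (Real.cosh (l * c) + (h a - μ) * (Real.sinh (l * c) / c)) :=
        Finset.sum_le_sum fun a _ => exp_le_cosh_sinh c l _ hc (hx a)
    _ = Fintype.card α * Real.cosh (l * c) := by
        rw [Finset.sum_add_distrib, ← Finset.sum_mul, hz]; simp
    _ ≤ _ := by
        rw [mul_comm]
        gcongr
        rw [← mul_pow]
        exact Real.cosh_le_exp_half_sq _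

theorem mcd_mgf {α : Type} [Fintype α] [Nonempty α] (c l : ℝ) (hc : 0 < c) :
    ∀ (n : ℕ) (f : (Fin n → α) → ℝ),
      (∀ ω g a, |f (Function.update ω g a) - f ω| ≤ c) →
      gE (fun ω => Real.exp (l * (f ω - gE f))) ≤ Real.exp (n * (l ^ 2 * c ^ 2 / 2)) := by
  intro n
  induction n with
  | zero =>
    intro f _
    have : ∀ ω, f ω - gE f = 0 := by
      intro ω
      unfold gE
      simp
      rw [Subsingleton.elim ω default]
      ring
    simp [this, gE_const]
  | succ n ih =>
    intro f hf
    have hN : (0:ℝ) < Fintype.card α := by exact_mod_cast Fintype.card_pos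
    set h : α → ℝ := fun a => gE (fun ω : Fin n → α => f (Fin.cons a ω)) with hh
    have hE : gE f = (∑ b, h b) / (Fintype.card α : ℝ) := gE_succ f
    have hd : ∀ a b, |h a - h b| ≤ c := by
      intro a b
      have key : ∀ ω : Fin n → α, |f (Fin.cons a ω) - f (Fin.cons b ω)| ≤ c := by
        intro ω
        have := hf (Fin.cons b ω) 0 a
        rwa [Fin.update_cons_zero] at this
      have h1 : ∀ a b, (∀ ω : Fin n → α, |f (Fin.cons a ω) - f (Fin.cons b ω)| ≤ c) →
          h a ≤ c + h b := by
        intro a b key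
        have e : c + h b = gE (fun ω : Fin n → α => c + f (Fin.cons b ω)) := by
          rw [gE_add, gE_const]
        rw [e]
        apply gE_mono
        intro ω
        have := (abs_le.1 (key ω)).2
        linarith
      rw [abs_le]
      constructor
      · have := h1 b a (fun ω => by rw [abs_sub_comm]; exact key ω)
        linarith
      · have := h1 a b key
        linarith
    rw [gE_succ, div_le_iff₀ hN]
    have step : ∀ a, gE (fun ω : Fin n → α => Real.exp (l * (f (Fin.cons a ω) - gE f)))
        ≤ Real.exp (l * (h a - gE f)) * Real.exp (n * (l ^ 2 * c ^ 2 / 2)) := by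
      intro a
      have := ih (fun ω => f (Fin.cons a ω)) (by
        intro ω g x
        have := hf (Fin.cons a ω) g.succ x
        rwa [← Fin.cons_update] at this)
      calc _ = gE (fun ω : Fin n → α => Real.exp (l * (h a - gE f)) *
              Real.exp (l * (f (Fin.cons a ω) - h a))) := by
            congr 1; funext ω; rw [← Real.exp_add]; congr 1; ring
        _ = _ := gE_const_mul _ _
        _ ≤ _ := by gcongr
    calc _ ≤ ∑ a, Real.exp (l * (h a - gE f)) * Real.exp (n * (l ^ 2 * c ^ 2 / 2)) :=
          Finset.sum_le_sum fun a _ => step a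
      _ = (∑ a, Real.exp (l * (h a - gE f))) * Real.exp (n * (l ^ 2 * c ^ 2 / 2)) := by
          rw [Finset.sum_mul]
      _ ≤ (Real.exp (l ^ 2 * c ^ 2 / 2) * Fintype.card α) * Real.exp (n * (l ^ 2 * c ^ 2 / 2)) := by
          gcongr
          have := avg_exp h c l hc hd
          rw [div_le_iff₀ hN] at this
          rw [hE]; exact this
      _ = _ := by
          push_cast
          rw [add_mul, Real.exp_add, one_mul]; ring

theorem mcd {α : Type} [Fintype α] [Nonempty α] (c s : ℝ) (hc : 0 < c) (hs : 0 < s)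
    (n : ℕ) (hn : 0 < n) (f : (Fin n → α) → ℝ)
    (hf : ∀ ω g a, |f (Function.update ω g a) - f ω| ≤ c) :
    gP (fun ω => f ω ≤ gE f - s) ≤ Real.exp (- (s ^ 2 / (2 * n * c ^ 2))) := by
  have hn' : (0:ℝ) < n := by exact_mod_cast hn
  set l : ℝ := - (s / (n * c ^ 2)) with hl
  have hl0 : l < 0 := by rw [hl]; have : 0 < s / (n * c ^ 2) := by positivity
                         linarith
  have h1 := mcd_mgf c l hc n f hf
  have h2 := gP_markov (fun ω => Real.exp (l * (f ω - gE f))) (fun ω => (Real.exp_pos _).le)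
    (Real.exp (-(l * s))) (Real.exp_pos _)
  refine le_trans (le_trans (gP_mono ?_) h2) ?_
  · intro ω h
    apply Real.exp_le_exp.2
    nlinarith
  · rw [div_le_iff₀ (Real.exp_pos _), ← Real.exp_add]
    refine h1.trans (le_of_eq ?_)
    congr 1
    rw [hl]
    field_simp
    ring

theorem cyl_eq {n : ℕ} {α V : Type} [Fintype α] [Nonempty α] (g : V → Fin n) (q : V → α)
    (Q : Finset V) (hg : Set.InjOn g Q) :
    gP (fun ω : Fin n → α => ∀ v ∈ Q, ω (g v) = q v)
      = (1 / (Fintype.card α : ℝ)) ^ Q.card := by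
  have hN : (Fintype.card α : ℝ) ≠ 0 := by exact_mod_cast Fintype.card_ne_zero
  have key : (univ.filter (fun ω : Fin n → α => ∀ v ∈ Q, ω (g v) = q v)).card
      * Fintype.card α ^ Q.card = Fintype.card α ^ n := by
    have e : (univ.filter (fun ω : Fin n → α => ∀ v ∈ Q, ω (g v) = q v))
        = Fintype.piFinset (fun i => if i ∈ Q.image g then
            univ.filter (fun a => ∀ v ∈ Q, g v = i → a = q v) else univ) := by
      ext ω
      simp only [mem_filter, mem_univ, true_and, Fintype.mem_piFinset]
      constructor
      · intro h i
        split_ifs with hi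
        · simp only [mem_filter, mem_univ, true_and]
          rintro v hv rfl
          exact h v hv
        · simp
      · intro h v hv
        have := h (g v)
        rw [if_pos (mem_image_of_mem g hv)] at this
        simp only [mem_filter, mem_univ, true_and] at this
        exact this v hv rfl
    rw [e, Fintype.card_piFinset]
    have c1 : ∀ i, (if i ∈ Q.image g then
            univ.filter (fun a => ∀ v ∈ Q, g v = i → a = q v) else univ).card
          = if i ∈ Q.image g then 1 else Fintype.card α := by
      intro i
      split_ifs with hi
      · obtain ⟨v, hv, rfl⟩ := mem_image.1 hi
        rw [card_eq_one]
        refine ⟨q v, ?_⟩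
        ext a
        simp only [mem_filter, mem_univ, true_and, mem_singleton]
        constructor
        · intro h; exact h v hv rfl
        · rintro rfl w hw hgw
          rw [hg hw hv hgw]
      · simp
    rw [Finset.prod_congr rfl (fun i _ => c1 i), Finset.prod_ite]
    simp only [prod_const, one_pow, one_mul]
    rw [← pow_add]
    congr 1
    have : (univ.filter (fun i => i ∈ Q.image g)).card = Q.card := by
      rw [Finset.filter_univ_mem, card_image_of_injOn hg]
    have h2 := Finset.card_filter_add_card_filter_not (s := (univ : Finset (Fin n))) (fun i => i ∈ Q.image g)
    rw [this] at h2
    simp only [card_univ, Fintype.card_fin] at h2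
    omega
  have k1 : gP (fun ω : Fin n → α => ∀ v ∈ Q, ω (g v) = q v) =
      ((univ.filter (fun ω : Fin n → α => ∀ v ∈ Q, ω (g v) = q v)).card : ℝ) /
        (Fintype.card α : ℝ) ^ n := by
    unfold gP gE
    rw [Finset.card_filter]
    push_cast
    congr!
  rw [k1, one_div, inv_pow]
  rw [div_eq_iff (pow_ne_zero _ hN)]
  have k2 : ((univ.filter (fun ω : Fin n → α => ∀ v ∈ Q, ω (g v) = q v)).card : ℝ)
      * (Fintype.card α : ℝ) ^ Q.card = (Fintype.card α : ℝ) ^ n := by exact_mod_cast key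
  rw [← k2]
  field_simp

theorem cyl_le {n : ℕ} {α V : Type} [Fintype α] [Nonempty α] (g : V → Fin n) (q : V → α)
    (Q : Finset V) (hg : Set.InjOn (fun v => (g v, q v)) Q) :
    gP (fun ω : Fin n → α => ∀ v ∈ Q, ω (g v) = q v)
      ≤ (1 / (Fintype.card α : ℝ)) ^ Q.card := by
  by_cases h : Set.InjOn g Q
  · exact (cyl_eq g q Q h).le
  · have : ∀ ω : Fin n → α, ¬ ∀ v ∈ Q, ω (g v) = q v := by
      intro ω hω
      apply h
      intro v hv w hw e
      apply hg hv hw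
      simp only [Prod.mk.injEq]
      exact ⟨e, by rw [← hω v hv, ← hω w hw, e]⟩
    unfold gP
    simp only [this, if_false, gE_const]
    positivity

/-- The class of vertices selected by `ω`. -/
def cls {n : ℕ} {α : Type} (V' : Finset ℕ) (g : ℕ → Fin n) (q : ℕ → α) (ω : Fin n → α) :
    Finset ℕ := V'.filter fun v => ω (g v) = q v

theorem mem_cls {n : ℕ} {α : Type} {V' : Finset ℕ} {g : ℕ → Fin n} {q : ℕ → α} {ω : Fin n → α}
    {v : ℕ} : v ∈ cls V' g q ω ↔ v ∈ V' ∧ ω (g v) = q v := by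
  simp [cls]

theorem cls_injOn {n : ℕ} {α : Type} {V' : Finset ℕ} {g : ℕ → Fin n} {q : ℕ → α}
    (hg : Set.InjOn (fun v => (g v, q v)) V') (ω : Fin n → α) :
    Set.InjOn g (cls V' g q ω) := by
  intro v hv w hw e
  rw [mem_coe, mem_cls] at hv hw
  apply hg hv.1 hw.1
  simp only [Prod.mk.injEq]
  exact ⟨e, by rw [← hv.2, ← hw.2, e]⟩

theorem card_cls_le {n : ℕ} {α : Type} {V' : Finset ℕ} {g : ℕ → Fin n} {q : ℕ → α}
    (hg : Set.InjOn (fun v => (g v, q v)) V') (ω : Fin n → α) :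
    (cls V' g q ω).card ≤ n := by
  rw [← card_image_of_injOn (cls_injOn hg ω)]
  exact (card_le_univ _).trans (by simp)

theorem count_contains (V p : Finset ℕ) (r : ℕ) :
    ((powersetCard r V).filter fun Q => p ⊆ Q).card * V.card ^ p.card ≤ V.card ^ r := by
  by_cases h : p.card ≤ r
  · have h1 : ((powersetCard r V).filter fun Q => p ⊆ Q).card
        ≤ (powersetCard (r - p.card) V).card := by
      apply card_le_card_of_injOn (fun Q => Q \ p)
      · intro Q hQ
        simp only [coe_filter, mem_powersetCard, Set.mem_ofPred_eq] at hQ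
        simp only [mem_coe, mem_powersetCard]
        refine ⟨sdiff_subset.trans hQ.1.1, ?_⟩
        rw [card_sdiff_of_subset hQ.2, hQ.1.2]
      · intro Q hQ Q' hQ' e
        simp only [coe_filter, Set.mem_ofPred_eq] at hQ hQ'
        simp only at e
        rw [← sdiff_union_of_subset hQ.2, e, sdiff_union_of_subset hQ'.2]
    rw [card_powersetCard] at h1
    calc _ ≤ V.card ^ (r - p.card) * V.card ^ p.card := by
          gcongr
          exact h1.trans (Nat.choose_le_pow _ _)
      _ = _ := by rw [← pow_add]; congr 1; omega
  · have : ((powersetCard r V).filter fun Q => p ⊆ Q) = ∅ := by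
      apply filter_eq_empty_iff.2
      intro Q hQ hp
      have := card_le_card hp
      rw [(mem_powersetCard.1 hQ).2] at this
      exact h this
    rw [this]; simp

theorem degIn_mono {k : ℕ} (G : HGraph k) (S : Finset ℕ) {A A' : Finset ℕ} (h : A ⊆ A') :
    G.degIn S A ≤ G.degIn S A' := by
  apply card_le_card
  intro e he
  simp only [mem_filter] at he ⊢
  exact ⟨he.1, he.2.1, he.2.2.trans h⟩

theorem degIn_erase {k : ℕ} (G : HGraph k) (S A : Finset ℕ) (hS : S.card < k) (x : ℕ)
    (hx : x ∈ A) :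
    G.degIn S A ≤ G.degIn S (A.erase x) + A.card ^ (k - S.card - 1) := by
  have hA : 0 < A.card := card_pos.2 ⟨x, hx⟩
  have hc : (G.edges.filter fun e => (S ⊆ e ∧ e \ S ⊆ A) ∧ ¬ (e \ S ⊆ A.erase x)).card
      ≤ A.card ^ (k - S.card - 1) := by
    have h1 : (G.edges.filter fun e => (S ⊆ e ∧ e \ S ⊆ A) ∧ ¬ (e \ S ⊆ A.erase x)).card
        ≤ ((powersetCard (k - S.card) A).filter fun Q => {x} ⊆ Q).card := by
      apply card_le_card_of_injOn (fun e => e \ S)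
      · intro e he
        simp only [coe_filter, Set.mem_ofPred_eq] at he
        obtain ⟨he, ⟨h1, h2⟩, h3⟩ := he
        simp only [coe_filter, mem_powersetCard, Set.mem_ofPred_eq]
        refine ⟨⟨h2, by rw [card_sdiff_of_subset h1, G.edge_card e he]⟩, ?_⟩
        rw [singleton_subset_iff]
        by_contra hxe
        apply h3
        intro v hv
        rw [mem_erase]
        exact ⟨fun h => hxe (h ▸ hv), h2 hv⟩
      · intro e he e' he' h
        simp only [coe_filter, Set.mem_ofPred_eq] at he he'
        simp only at h
        rw [← sdiff_union_of_subset he.2.1.1, h, sdiff_union_of_subset he'.2.1.1]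
    have h2 := count_contains A {x} (k - S.card)
    have h3 : A.card ^ (k - S.card) = A.card ^ (k - S.card - 1) * A.card := by
      rw [← pow_succ]; congr 1; omega
    rw [card_singleton, pow_one, h3] at h2
    exact h1.trans (Nat.le_of_mul_le_mul_right h2 hA)
  refine le_trans ?_ (Nat.add_le_add_left hc _)
  unfold HGraph.degIn
  refine le_trans (card_le_card ?_) (card_union_le _ _)
  intro e he
  simp only [mem_union, mem_filter] at he ⊢
  tauto

theorem degIn_diff {k n : ℕ} {α : Type} (G : HGraph k) (S V' : Finset ℕ) (hS : S.card < k)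
    (g : ℕ → Fin n) (q : ℕ → α)
    (hg : Set.InjOn (fun v => (g v, q v)) V') (ω ω' : Fin n → α) (i : Fin n)
    (h : ∀ i', i' ≠ i → ω' i' = ω i') :
    G.degIn S (cls V' g q ω') ≤ G.degIn S (cls V' g q ω) + n ^ (k - S.card - 1) := by
  by_cases hx : ∃ x ∈ cls V' g q ω', g x = i
  · obtain ⟨x, hx, hxi⟩ := hx
    refine (degIn_erase G S _ hS x hx).trans ?_
    gcongr
    · apply degIn_mono
      intro v hv
      rw [mem_erase] at hv
      have hv2 := mem_cls.1 hv.2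
      rw [mem_cls]
      refine ⟨hv2.1, ?_⟩
      rw [← hv2.2, h]
      intro hvi
      exact hv.1 (cls_injOn hg ω' hv.2 hx (hvi.trans hxi.symm))
    · exact card_cls_le hg ω'
  · push Not at hx
    refine le_trans (degIn_mono G S ?_) (Nat.le_add_right _ _)
    intro v hv
    have hv2 := mem_cls.1 hv
    rw [mem_cls]
    exact ⟨hv2.1, by rw [← hv2.2, h _ (hx v hv)]⟩

theorem degIn_bd {k n : ℕ} {α : Type} (G : HGraph k) (S V' : Finset ℕ) (hS : S.card < k)
    (g : ℕ → Fin n) (q : ℕ → α)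
    (hg : Set.InjOn (fun v => (g v, q v)) V') (ω : Fin n → α) (i : Fin n) (a : α) :
    |(G.degIn S (cls V' g q (Function.update ω i a)) : ℝ) - (G.degIn S (cls V' g q ω) : ℝ)|
      ≤ (n : ℝ) ^ (k - S.card - 1) := by
  have h1 := degIn_diff G S V' hS g q hg ω (Function.update ω i a) i
    (fun i' h => Function.update_of_ne h _ _)
  have h2 := degIn_diff G S V' hS g q hg (Function.update ω i a) ω i
    (fun i' h => (Function.update_of_ne h _ _).symm)
  have h1' : (G.degIn S (cls V' g q (Function.update ω i a)) : ℝ) ≤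
    (G.degIn S (cls V' g q ω) : ℝ) + (n : ℝ) ^ (k - S.card - 1) := by exact_mod_cast h1
  have h2' : (G.degIn S (cls V' g q ω) : ℝ) ≤
    (G.degIn S (cls V' g q (Function.update ω i a)) : ℝ) + (n : ℝ) ^ (k - S.card - 1) := by
      exact_mod_cast h2
  rw [abs_le]
  constructor <;> linarith

theorem exp_lower {k n : ℕ} {α : Type} [Fintype α] [Nonempty α] (G : HGraph k)
    (S V' : Finset ℕ) (hV : V' ⊆ G.verts)
    (g : ℕ → Fin n) (q : ℕ → α) (hg : Set.InjOn (fun v => (g v, q v)) V') (a : ℝ)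
    (ha : ((G.verts \ V').card : ℝ) ≤ a) (hm : 0 < G.verts.card) :
    ((G.degOn S : ℝ) - (a + Fintype.card α) / G.verts.card * (G.verts.card : ℝ) ^ (k - S.card))
        * (1 / (Fintype.card α : ℝ)) ^ (k - S.card)
      ≤ gE (fun ω => (G.degIn S (cls V' g q ω) : ℝ)) := by
  set r := k - S.card with hr
  set m := G.verts.card with hmdef
  have hm' : (0:ℝ) < m := by exact_mod_cast hm
  set 𝒢 := G.edges.filter (fun e => S ⊆ e ∧ e \ S ⊆ V' ∧ Set.InjOn g (e \ S : Finset ℕ)) with h𝒢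
  set P := V'.biUnion (fun v => (V'.filter fun w => g w = g v ∧ w ≠ v).image
    fun w => ({v, w} : Finset ℕ)) with hP
  have hPcard : P.card ≤ m * Fintype.card α := by
    refine le_trans card_biUnion_le ?_
    refine le_trans (sum_le_card_nsmul _ _ (Fintype.card α) ?_) ?_
    · intro v hv
      refine card_image_le.trans ?_
      have : Set.InjOn q (V'.filter fun w => g w = g v ∧ w ≠ v) := by
        intro x hx y hy e
        simp only [coe_filter, Set.mem_ofPred_eq] at hx hy
        apply hg hx.1 hy.1
        simp only [Prod.mk.injEq]
        exact ⟨hx.2.1.trans hy.2.1.symm, e⟩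
      rw [← card_image_of_injOn this]
      exact card_le_univ _
    · rw [smul_eq_mul]
      gcongr
      exact card_le_card hV
  have hP2 : ∀ p ∈ P, p.card = 2 := by
    intro p hp
    simp only [hP, mem_biUnion, mem_image, mem_filter] at hp
    obtain ⟨v, _, w, hw, rfl⟩ := hp
    exact card_pair hw.2.2.symm
  set b1 := (G.verts \ V').biUnion
    (fun v => (powersetCard r G.verts).filter fun Q => {v} ⊆ Q) with hb1
  set b2 := P.biUnion
    (fun p => (powersetCard r G.verts).filter fun Q => p ⊆ Q) with hb2
  have hb1c : (b1.card : ℝ) ≤ a / m * (m : ℝ) ^ r := by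
    have h1 : (b1.card : ℝ) * m ≤ (G.verts \ V').card * (m:ℝ) ^ r := by
      have : b1.card * m ≤ (G.verts \ V').card * m ^ r := by
        calc b1.card * m ≤ (∑ v ∈ G.verts \ V',
              ((powersetCard r G.verts).filter fun Q => {v} ⊆ Q).card) * m := by
              gcongr; exact card_biUnion_le
          _ ≤ (G.verts \ V').card * m ^ r := by
              rw [sum_mul]
              refine le_trans (sum_le_card_nsmul _ _ (m ^ r) ?_) (by simp)
              intro v _
              have := count_contains G.verts {v} r
              simpa using this
      exact_mod_cast this
    rw [div_mul_eq_mul_div, le_div_iff₀ hm']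
    exact h1.trans (by gcongr)
  have hb2c : (b2.card : ℝ) ≤ Fintype.card α / m * (m : ℝ) ^ r := by
    have h1 : (b2.card : ℝ) * m ^ 2 ≤ (m * Fintype.card α) * (m:ℝ) ^ r := by
      have : b2.card * m ^ 2 ≤ (m * Fintype.card α) * m ^ r := by
        calc b2.card * m ^ 2 ≤ (∑ p ∈ P,
              ((powersetCard r G.verts).filter fun Q => p ⊆ Q).card) * m ^ 2 := by
              gcongr; exact card_biUnion_le
          _ ≤ P.card * m ^ r := by
              rw [sum_mul]
              refine le_trans (sum_le_card_nsmul _ _ (m ^ r) ?_) (by simp)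
              intro p hp
              have := count_contains G.verts p r
              rwa [hP2 p hp] at this
          _ ≤ _ := by gcongr
      exact_mod_cast this
    rw [div_mul_eq_mul_div, le_div_iff₀ hm']
    nlinarith
  have hsub : (G.edges.filter fun e => S ⊆ e ∧ ¬ (e \ S ⊆ V' ∧ Set.InjOn g (e \ S : Finset ℕ))).card
      ≤ (b1 ∪ b2).card := by
    apply card_le_card_of_injOn (fun e => e \ S)
    · intro e he
      simp only [coe_filter, Set.mem_ofPred_eq] at he
      obtain ⟨he, h1, h2⟩ := he
      have hQ : e \ S ∈ powersetCard r G.verts := by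
        rw [mem_powersetCard]
        exact ⟨sdiff_subset.trans (G.edge_sub e he), by rw [card_sdiff_of_subset h1, G.edge_card e he]⟩
      rw [mem_coe, mem_union]
      by_cases h3 : e \ S ⊆ V'
      · right
        have h4 : ¬ Set.InjOn g (e \ S : Finset ℕ) := fun h => h2 ⟨h3, h⟩
        unfold Set.InjOn at h4
        push Not at h4
        obtain ⟨v, hv, w, hw, hvw, hne⟩ := h4
        rw [hb2, mem_biUnion]
        refine ⟨{v, w}, ?_, ?_⟩
        · rw [hP, mem_biUnion]
          refine ⟨v, h3 hv, ?_⟩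
          rw [mem_image]
          exact ⟨w, mem_filter.2 ⟨h3 hw, hvw.symm, hne.symm⟩, rfl⟩
        · rw [mem_filter]
          refine ⟨hQ, ?_⟩
          intro x hx
          simp only [mem_insert, mem_singleton] at hx
          rcases hx with rfl | rfl
          · exact hv
          · exact hw
      · left
        obtain ⟨v, hv, hv'⟩ := not_subset.1 h3
        rw [hb1, mem_biUnion]
        exact ⟨v, mem_sdiff.2 ⟨(mem_powersetCard.1 hQ).1 hv, hv'⟩,
          mem_filter.2 ⟨hQ, singleton_subset_iff.2 hv⟩⟩
    · intro e he e' he' h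
      simp only [coe_filter, Set.mem_ofPred_eq] at he he'
      simp only at h
      rw [← sdiff_union_of_subset he.2.1, h, sdiff_union_of_subset he'.2.1]
  have hdeg : (G.degOn S : ℝ) ≤ 𝒢.card + (b1.card + b2.card) := by
    have : G.degOn S ≤ 𝒢.card + (b1.card + b2.card) := by
      refine le_trans ?_ (Nat.add_le_add_left (hsub.trans (card_union_le _ _)) _)
      unfold HGraph.degOn
      refine le_trans (card_le_card ?_) (card_union_le _ _)
      intro e he
      simp only [h𝒢, mem_union, mem_filter] at he ⊢
      tauto
    exact_mod_cast this
  have hE : (𝒢.card : ℝ) * (1 / (Fintype.card α : ℝ)) ^ r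
      ≤ gE (fun ω => (G.degIn S (cls V' g q ω) : ℝ)) := by
    have e1 : (𝒢.card : ℝ) * (1 / (Fintype.card α : ℝ)) ^ r
        = ∑ e ∈ 𝒢, gP (fun ω : Fin n → α => ∀ v ∈ e \ S, ω (g v) = q v) := by
      rw [← nsmul_eq_mul, ← sum_const]
      apply sum_congr rfl
      intro e he
      simp only [h𝒢, mem_filter] at he
      rw [cyl_eq g q (e \ S) he.2.2.2, card_sdiff_of_subset he.2.1, G.edge_card e he.1]
    rw [e1]
    unfold gP
    rw [← gE_sum]
    apply gE_mono
    intro ω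
    have : (𝒢.filter fun e => ∀ v ∈ e \ S, ω (g v) = q v).card ≤ G.degIn S (cls V' g q ω) := by
      apply card_le_card
      intro e he
      simp only [h𝒢, mem_filter] at he ⊢
      refine ⟨he.1.1, he.1.2.1, ?_⟩
      intro v hv
      rw [mem_cls]
      exact ⟨he.1.2.2.1 hv, he.2 v hv⟩
    refine le_trans (le_of_eq ?_) (Nat.cast_le.2 this)
    rw [card_filter]
    push_cast
    congr!
  refine le_trans ?_ hE
  gcongr
  have : (a + Fintype.card α) / m * (m : ℝ) ^ r = a / m * (m : ℝ) ^ r +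
    Fintype.card α / m * (m : ℝ) ^ r := by ring
  rw [this]
  linarith

theorem vb_det (X : Finset (Finset ℕ)) (U F : Finset ℕ) (hU : U.Nonempty)
    (hX : ∀ b ∈ X, b.card = 2 ∧ b ⊆ U ∪ F ∧ (b ∩ U).Nonempty)
    (h : ¬ ∃ u ∈ U, ∀ b ∈ X, u ∈ b) :
    (∃ b₁ ∈ X, ∃ b₂ ∈ X, Disjoint (b₁ ∩ U) (b₂ ∩ U)) ∨
    (∃ b₁ ∈ X, ∃ b₂ ∈ X, b₁ ≠ b₂ ∧ ¬ Disjoint b₁ b₂ ∧ b₁ ⊆ U ∧ b₂ ⊆ U) := by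
  push Not at h
  obtain ⟨u, hu⟩ := hU
  obtain ⟨b₀, hb₀, _⟩ := h u hu
  by_cases h1 : ∃ b ∈ X, (b ∩ U).card = 1
  · left
    obtain ⟨b, hb, hc⟩ := h1
    obtain ⟨x, hx⟩ := card_eq_one.1 hc
    have hxU : x ∈ b ∩ U := by rw [hx]; simp
    obtain ⟨b', hb', hxb'⟩ := h x (mem_inter.1 hxU).2
    refine ⟨b, hb, b', hb', ?_⟩
    rw [hx, disjoint_singleton_left]
    exact fun hh => hxb' (mem_inter.1 hh).1
  · push Not at h1
    have hsub : ∀ b ∈ X, b ⊆ U := by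
      intro b hb
      have h2 : (b ∩ U).card ≤ b.card := card_le_card inter_subset_left
      have h3 := card_pos.2 (hX b hb).2.2
      have h4 := h1 b hb
      have h5 := (hX b hb).1
      have : b ∩ U = b := eq_of_subset_of_card_le inter_subset_left (by omega)
      exact inter_eq_left.1 this
    obtain ⟨x, hx⟩ := (hX b₀ hb₀).2.2
    obtain ⟨b', hb', hxb'⟩ := h x (mem_inter.1 hx).2
    by_cases hd : Disjoint b₀ b'
    · left
      exact ⟨b₀, hb₀, b', hb', hd.mono inter_subset_left inter_subset_left⟩
    · right
      refine ⟨b₀, hb₀, b', hb', ?_, hd, hsub _ hb₀, hsub _ hb'⟩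
      rintro rfl
      exact hxb' (mem_inter.1 hx).1

/-- Candidate bad edges. -/
def cand (V' F : Finset ℕ) (B : Finset (Finset ℕ)) : Finset (Finset ℕ) :=
  B.filter fun b => b ⊆ V' ∪ F ∧ (b ∩ V').Nonempty

theorem card_B_le (B : Finset (Finset ℕ)) (V : Finset ℕ) (D : ℕ)
    (hB : ∀ b ∈ B, b ⊆ V ∧ b.card = 2)
    (hD : ∀ v : ℕ, (B.filter fun b => v ∈ b).card ≤ D) : B.card ≤ V.card * D := by
  have : B ⊆ V.biUnion fun v => B.filter fun b => v ∈ b := by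
    intro b hb
    have h2 := (hB b hb).2
    obtain ⟨v, hv⟩ := card_pos.1 (show 0 < b.card by omega)
    simp only [mem_biUnion, mem_filter]
    exact ⟨v, (hB b hb).1 hv, hb, hv⟩
  refine (card_le_card this).trans (card_biUnion_le.trans ?_)
  refine (sum_le_card_nsmul _ _ D fun v _ => hD v).trans (by simp)

theorem cand_weight (V' F : Finset ℕ) (B : Finset (Finset ℕ)) (D K : ℕ) (x : ℝ) (hx : 0 ≤ x)
    (hB : ∀ b ∈ B, b.card = 2)
    (hD : ∀ v : ℕ, (B.filter fun b => v ∈ b).card ≤ D) (hF : F.card ≤ K) :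
    ∑ b ∈ cand V' F B, x ^ (b ∩ V').card ≤ K * D * x + B.card * x ^ 2 := by
  rw [← sum_filter_add_sum_filter_not _ (fun b => (b ∩ V').card = 1)]
  apply add_le_add
  · have h1 : ((cand V' F B).filter fun b => (b ∩ V').card = 1).card ≤ K * D := by
      have : ((cand V' F B).filter fun b => (b ∩ V').card = 1) ⊆
          F.biUnion fun v => B.filter fun b => v ∈ b := by
        intro b hb
        simp only [cand, mem_filter] at hb
        have h2 := hB b hb.1.1
        have : ∃ v ∈ b, v ∉ V' := by
          by_contra hc
          push Not at hc
          have : b ∩ V' = b := inter_eq_left.2 hc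
          rw [this] at hb
          omega
        obtain ⟨v, hv, hv'⟩ := this
        simp only [mem_biUnion, mem_filter]
        refine ⟨v, ?_, hb.1.1, hv⟩
        have := hb.1.2.1 hv
        rw [mem_union] at this
        tauto
      refine (card_le_card this).trans (card_biUnion_le.trans ?_)
      refine (sum_le_card_nsmul _ _ D fun v _ => hD v).trans ?_
      rw [smul_eq_mul]; gcongr
    calc _ = ∑ b ∈ (cand V' F B).filter (fun b => (b ∩ V').card = 1), x := by
          apply sum_congr rfl
          intro b hb
          rw [(mem_filter.1 hb).2, pow_one]
      _ = ((cand V' F B).filter fun b => (b ∩ V').card = 1).card * x := by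
          rw [sum_const, nsmul_eq_mul]
      _ ≤ _ := by
          gcongr
          exact_mod_cast h1
  · calc _ = ∑ b ∈ (cand V' F B).filter (fun b => ¬ (b ∩ V').card = 1), x ^ 2 := by
          apply sum_congr rfl
          intro b hb
          simp only [cand, mem_filter] at hb
          have h2 := hB b hb.1.1
          have h3 := card_pos.2 hb.1.2.2
          have h4 : (b ∩ V').card ≤ b.card := card_le_card inter_subset_left
          have : (b ∩ V').card = 2 := by omega
          rw [this]
      _ = ((cand V' F B).filter fun b => ¬ (b ∩ V').card = 1).card * x ^ 2 := by
          rw [sum_const, nsmul_eq_mul]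
      _ ≤ _ := by
          gcongr
          exact (filter_subset _ _).trans (filter_subset _ _)

theorem bad_prob {n : ℕ} {α : Type} [Fintype α] [Nonempty α] (V' F : Finset ℕ)
    (g : ℕ → Fin n) (q : ℕ → α) (hg : Set.InjOn (fun v => (g v, q v)) V')
    (hVF : Disjoint V' F)
    (B : Finset (Finset ℕ)) (D K : ℕ)
    (hB : ∀ b ∈ B, b.card = 2)
    (hD : ∀ v : ℕ, (B.filter fun b => v ∈ b).card ≤ D) (hF : F.card ≤ K) :
    gP (fun ω : Fin n → α => ∃ b ∈ cand V' F B, b ⊆ cls V' g q ω ∪ F) ≤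
      K * D * (1 / (Fintype.card α : ℝ)) + B.card * (1 / (Fintype.card α : ℝ)) ^ 2 := by
  refine le_trans ?_ (cand_weight V' F B D K (1 / (Fintype.card α : ℝ)) (by positivity) hB hD hF)
  refine (gP_union _ _).trans (sum_le_sum fun b hb => ?_)
  refine le_trans (gP_mono ?_) (cyl_le g q (b ∩ V') (hg.mono (by
    intro v hv; exact (mem_inter.1 hv).2)))
  intro ω h v hv
  rw [mem_inter] at hv
  have := h hv.1
  rw [mem_union] at this
  rcases this with h1 | h1
  · exact (mem_cls.1 h1).2
  · exact absurd h1 (disjoint_left.1 hVF hv.2)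

theorem verybad_prob {n : ℕ} {α : Type} [Fintype α] [Nonempty α] (V' F : Finset ℕ)
    (g : ℕ → Fin n) (q : ℕ → α) (hg : Set.InjOn (fun v => (g v, q v)) V')
    (hVF : Disjoint V' F)
    (B : Finset (Finset ℕ)) (D K : ℕ)
    (hB : ∀ b ∈ B, b.card = 2)
    (hD : ∀ v : ℕ, (B.filter fun b => v ∈ b).card ≤ D) (hF : F.card ≤ K)
    (hne : ∀ ω : Fin n → α, (cls V' g q ω).Nonempty) :
    gP (fun ω : Fin n → α => ¬ ∃ u ∈ cls V' g q ω, ∀ b ∈ cand V' F B,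
        b ⊆ cls V' g q ω ∪ F → u ∈ b) ≤
      (K * D * (1 / (Fintype.card α : ℝ)) + B.card * (1 / (Fintype.card α : ℝ)) ^ 2) ^ 2
        + B.card * (2 * D) * (1 / (Fintype.card α : ℝ)) ^ 3 := by
  set x : ℝ := 1 / (Fintype.card α : ℝ) with hx
  have hx0 : 0 ≤ x := by positivity
  set C := cand V' F B with hC
  have key : ∀ ω : Fin n → α, (¬ ∃ u ∈ cls V' g q ω, ∀ b ∈ C,
        b ⊆ cls V' g q ω ∪ F → u ∈ b) →
      (∃ p ∈ C ×ˢ C, Disjoint (p.1 ∩ V') (p.2 ∩ V') ∧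
        ∀ v ∈ (p.1 ∩ V') ∪ (p.2 ∩ V'), ω (g v) = q v) ∨
      (∃ p ∈ B.sigma (fun b => B.filter fun b' => b ≠ b' ∧ ¬ Disjoint b b' ∧ b ∪ b' ⊆ V'),
        ∀ v ∈ p.1 ∪ p.2, ω (g v) = q v) := by
    intro ω h
    have tr : ∀ b, b ⊆ cls V' g q ω ∪ F → b ∩ V' = b ∩ cls V' g q ω := by
      intro b hb
      ext v
      simp only [mem_inter]
      constructor
      · rintro ⟨h1, h2⟩
        refine ⟨h1, ?_⟩
        have := hb h1
        rw [mem_union] at this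
        rcases this with h3 | h3
        · exact h3
        · exact absurd h3 (disjoint_left.1 hVF h2)
      · rintro ⟨h1, h2⟩
        exact ⟨h1, (mem_cls.1 h2).1⟩
    rcases vb_det (C.filter fun b => b ⊆ cls V' g q ω ∪ F) (cls V' g q ω) F (hne ω) (by
      intro b hb
      rw [mem_filter] at hb
      refine ⟨hB b (mem_filter.1 hb.1).1, hb.2, ?_⟩
      rw [← tr b hb.2]
      exact (mem_filter.1 hb.1).2.2) (by
      rintro ⟨u, hu, h2⟩
      exact h ⟨u, hu, fun b hb hb' => h2 b (mem_filter.2 ⟨hb, hb'⟩)⟩) with h1 | h1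
    · left
      obtain ⟨b₁, hb₁, b₂, hb₂, hd⟩ := h1
      rw [mem_filter] at hb₁ hb₂
      refine ⟨(b₁, b₂), mem_product.2 ⟨hb₁.1, hb₂.1⟩, ?_⟩
      simp only [tr b₁ hb₁.2, tr b₂ hb₂.2]
      refine ⟨hd, ?_⟩
      intro v hv
      simp only [mem_union, mem_inter] at hv
      rcases hv with hv | hv <;> exact (mem_cls.1 hv.2).2
    · right
      obtain ⟨b₁, hb₁, b₂, hb₂, hne', hd, hs1, hs2⟩ := h1
      rw [mem_filter] at hb₁ hb₂
      have hcV : cls V' g q ω ⊆ V' := fun v hv => (mem_cls.1 hv).1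
      refine ⟨⟨b₁, b₂⟩, ?_, ?_⟩
      · simp only [mem_sigma, mem_filter]
        exact ⟨(mem_filter.1 hb₁.1).1, (mem_filter.1 hb₂.1).1, hne', hd,
          union_subset (hs1.trans hcV) (hs2.trans hcV)⟩
      · intro v hv
        simp only [mem_union] at hv
        rcases hv with hv | hv
        · exact (mem_cls.1 (hs1 hv)).2
        · exact (mem_cls.1 (hs2 hv)).2
  refine (gP_mono key).trans ((gP_or _ _).trans (add_le_add ?_ ?_))
  · refine (gP_union _ _).trans ?_
    calc _ ≤ ∑ p ∈ C ×ˢ C, x ^ (p.1 ∩ V').card * x ^ (p.2 ∩ V').card := by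
          apply sum_le_sum
          intro p _
          by_cases hd : Disjoint (p.1 ∩ V') (p.2 ∩ V')
          · rw [← pow_add, ← card_union_of_disjoint hd]
            refine le_trans (gP_mono fun ω h => h.2) (cyl_le g q _ (hg.mono ?_))
            rw [coe_subset]
            exact union_subset inter_subset_right inter_subset_right
          · simp only [hd, false_and]
            unfold gP
            simp only [if_false, gE_const]
            positivity
      _ = (∑ b ∈ C, x ^ (b ∩ V').card) ^ 2 := by
          rw [sum_product, sq, sum_mul_sum]
      _ ≤ _ := by
          gcongr
          exact cand_weight V' F B D K x hx0 hB hD hF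
  · refine (gP_union _ _).trans ?_
    have hcard : (B.sigma (fun b => B.filter fun b' =>
        b ≠ b' ∧ ¬ Disjoint b b' ∧ b ∪ b' ⊆ V')).card ≤ B.card * (2 * D) := by
      rw [card_sigma]
      refine (sum_le_card_nsmul _ _ (2 * D) ?_).trans (by simp)
      intro b hb
      have : (B.filter fun b' => b ≠ b' ∧ ¬ Disjoint b b' ∧ b ∪ b' ⊆ V') ⊆
          b.biUnion fun v => B.filter fun b' => v ∈ b' := by
        intro b' hb'
        rw [mem_filter] at hb'
        obtain ⟨v, hv, hv'⟩ := not_disjoint_iff.1 hb'.2.2.1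
        simp only [mem_biUnion, mem_filter]
        exact ⟨v, hv, hb'.1, hv'⟩
      refine (card_le_card this).trans (card_biUnion_le.trans ?_)
      refine (sum_le_card_nsmul _ _ D fun v _ => hD v).trans ?_
      rw [smul_eq_mul, hB b hb]
    calc _ ≤ ∑ p ∈ B.sigma (fun b => B.filter fun b' =>
            b ≠ b' ∧ ¬ Disjoint b b' ∧ b ∪ b' ⊆ V'), x ^ 3 := by
          apply sum_le_sum
          intro p hp
          simp only [mem_sigma, mem_filter] at hp
          obtain ⟨h1, h2, h3, h4, h5⟩ := hp
          have c3 : (p.1 ∪ p.2).card = 3 := by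
            have e1 := card_union_add_card_inter p.1 p.2
            have e2 : 0 < (p.1 ∩ p.2).card := by
              rw [card_pos]
              exact not_disjoint_iff_nonempty_inter.1 h4
            have e3 : (p.1 ∩ p.2).card ≠ 2 := by
              intro e
              apply h3
              have i1 : p.1 ∩ p.2 = p.1 := eq_of_subset_of_card_le inter_subset_left
                (by rw [hB _ h1, e])
              have i2 : p.1 ∩ p.2 = p.2 := eq_of_subset_of_card_le inter_subset_right
                (by rw [hB _ h2, e])
              rw [← i1, i2]
            have e4 : (p.1 ∩ p.2).card ≤ p.1.card := card_le_card inter_subset_left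
            rw [hB _ h1, hB _ h2] at e1
            rw [hB _ h1] at e4
            omega
          rw [← c3]
          exact cyl_le g q _ (hg.mono (coe_subset.2 h5))
      _ ≤ _ := by
          rw [sum_const, nsmul_eq_mul]
          gcongr
          exact_mod_cast hcard

theorem grouping (V' : Finset ℕ) (N M c : ℕ) [NeZero M] (hV : V'.card = N * M + c) (hc : c < M) :
    ∃ (g : ℕ → Fin (N + 1)) (p : ℕ → ZMod M), Set.InjOn (fun v => (g v, p v)) V' ∧
      ∀ i : Fin (N + 1), i.val < N → ∀ a : ZMod M, ∃ v ∈ V', g v = i ∧ p v = a := by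
  have hM : 0 < M := Nat.pos_of_ne_zero (NeZero.ne M)
  let e := V'.equivFin
  let idx : ℕ → ℕ := fun v => if h : v ∈ V' then (e ⟨v, h⟩).val else 0
  have hidx : ∀ v, idx v < (N + 1) * M := by
    intro v
    simp only [idx]
    split_ifs with h
    · have := lt_of_lt_of_eq (e ⟨v, h⟩).isLt hV
      rw [add_mul, one_mul]
      omega
    · positivity
  refine ⟨fun v => ⟨idx v / M, (Nat.div_lt_iff_lt_mul hM).2 (hidx v)⟩, fun v => (idx v : ZMod M),
    ?_, ?_⟩
  · intro v hv w hw h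
    simp only [Prod.mk.injEq, Fin.mk.injEq] at h
    have h2 := (ZMod.natCast_eq_natCast_iff' _ _ _).1 h.2
    have h3 : idx v = idx w := by
      rw [← Nat.div_add_mod (idx v) M, h.1, h2, Nat.div_add_mod]
    simp only [idx] at h3
    rw [dif_pos (mem_coe.1 hv), dif_pos (mem_coe.1 hw)] at h3
    have := e.injective (Fin.ext h3)
    simpa using this
  · intro i hi a
    have ha := ZMod.val_lt a
    have hlt : i.val * M + a.val < V'.card := by
      rw [hV]
      have : (i.val + 1) * M ≤ N * M := Nat.mul_le_mul_right _ hi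
      rw [add_mul, one_mul] at this
      omega
    set v := e.symm ⟨i.val * M + a.val, hlt⟩ with hv
    have hiv : idx v = i.val * M + a.val := by
      simp only [idx]
      rw [dif_pos v.2]
      simp [hv]
    refine ⟨v, v.2, ?_, ?_⟩
    · apply Fin.ext
      simp only [hiv]
      rw [mul_comm, Nat.mul_add_div hM, Nat.div_eq_of_lt ha, add_zero]
    · simp [hiv]

theorem card_cls_ge {N : ℕ} {α : Type} {V' : Finset ℕ} {g : ℕ → Fin (N + 1)} {q : ℕ → α}
    (hq : ∀ i : Fin (N + 1), i.val < N → ∀ a, ∃ v ∈ V', g v = i ∧ q v = a)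
    (ω : Fin (N + 1) → α) : N ≤ (cls V' g q ω).card := by
  have h1 : (univ.filter fun i : Fin (N + 1) => i.val < N) ⊆ (cls V' g q ω).image g := by
    intro i hi
    rw [mem_filter] at hi
    obtain ⟨v, hv, h1, h2⟩ := hq i hi.2 (ω i)
    rw [mem_image]
    exact ⟨v, mem_cls.2 ⟨hv, by rw [h1, h2]⟩, h1⟩
  have h2 : (univ.filter fun i : Fin (N + 1) => i.val < N).card = N := by
    have := Fin.card_filter_val_lt (n := N + 1) (m := N)
    simpa using this
  exact h2.ge.trans <| (card_le_card h1).trans card_image_le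

theorem partB {k n : ℕ} {α : Type} [Fintype α] [Nonempty α] (G : HGraph k)
    (S V' : Finset ℕ) (hV : V' ⊆ G.verts) (hS : S.card < k)
    (g : ℕ → Fin n) (q : ℕ → α) (hg : Set.InjOn (fun v => (g v, q v)) V')
    (T : ℕ) (hT : 0 < T) (hm : G.verts.card = T * Fintype.card α)
    (hc : (G.verts \ V').card ≤ k * Fintype.card α) (hn : 0 < n) (hnT : n ≤ T)
    (d ε : ℝ) (hε : 0 < ε)
    (hdeg : (d + ε / 4) * (G.verts.card : ℝ) ^ (k - S.card) ≤ G.degOn S)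
    (hb : ((k : ℝ) + 1) / T ≤ ε / 64) :
    gP (fun ω : Fin n → α => (G.degIn S (cls V' g q ω) : ℝ) < (d + 7 * ε / 32) * (T : ℝ) ^ (k - S.card))
      ≤ Real.exp (-((ε / 64) ^ 2 * T / 2)) := by
  have hM : (0:ℝ) < Fintype.card α := by exact_mod_cast Fintype.card_pos
  have hT' : (0:ℝ) < T := by exact_mod_cast hT
  have hn' : (0:ℝ) < n := by exact_mod_cast hn
  have hnT' : (n:ℝ) ≤ T := by exact_mod_cast hnT
  have hm' : (G.verts.card : ℝ) = T * Fintype.card α := by exact_mod_cast hm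
  have hmpos : 0 < G.verts.card := by rw [hm]; exact Nat.mul_pos hT Fintype.card_pos
  have h1 := exp_lower G S V' hV g q hg ((k : ℝ) * Fintype.card α) (by exact_mod_cast hc) hmpos
  set r := k - S.card with hr
  set f : (Fin n → α) → ℝ := fun ω => (G.degIn S (cls V' g q ω) : ℝ) with hf
  have h2 : (d + ε / 4 - ε / 64) * (T : ℝ) ^ r ≤ gE f := by
    refine le_trans ?_ h1
    have e1 : (d + ε / 4 - ε / 64) * (T : ℝ) ^ r
        = ((d + ε / 4 - ε / 64) * (G.verts.card : ℝ) ^ r) * (1 / (Fintype.card α : ℝ)) ^ r := by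
      rw [hm', mul_pow, one_div, inv_pow]
      field_simp
    rw [e1]
    gcongr
    have e2 : ((k : ℝ) * Fintype.card α + Fintype.card α) / G.verts.card = ((k : ℝ) + 1) / T := by
      rw [hm']; field_simp
    rw [e2]
    have e3 : ((k : ℝ) + 1) / T * (G.verts.card : ℝ) ^ r ≤ ε / 64 * (G.verts.card : ℝ) ^ r := by
      gcongr
    linarith
  have h3 := mcd ((T : ℝ) ^ (r - 1)) (ε / 64 * (T : ℝ) ^ r) (by positivity) (by positivity) n hn f
    (fun ω i a => (degIn_bd G S V' hS g q hg ω i a).trans (by gcongr))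
  refine le_trans (le_trans (gP_mono ?_) h3) ?_
  · intro ω h
    have : f ω < (d + 7 * ε / 32) * (T : ℝ) ^ r := h
    nlinarith
  · apply Real.exp_le_exp.2
    apply neg_le_neg
    rw [le_div_iff₀ (by positivity)]
    have e4 : (T : ℝ) ^ r = T ^ (r - 1) * T := by
      rw [← pow_succ]; congr 1; omega
    rw [e4]
    calc (ε / 64) ^ 2 * T / 2 * (2 * n * ((T : ℝ) ^ (r - 1)) ^ 2)
        ≤ (ε / 64) ^ 2 * T / 2 * (2 * T * ((T : ℝ) ^ (r - 1)) ^ 2) := by gcongr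
      _ = _ := by ring

theorem asym1 (k r : ℕ) (d ε : ℝ) (hε : 0 < ε) :
    ∃ X₀ : ℝ, ∀ X ≥ X₀, (d + 3 * ε / 16) * (X + k) ^ r ≤ (d + 7 * ε / 32) * X ^ r ∧
      ((k : ℝ) + 1) / X ≤ ε / 64 := by
  have h1 : Filter.Tendsto (fun X : ℝ => ((k : ℝ) + 1) / X) Filter.atTop (nhds 0) :=
    tendsto_const_nhds.div_atTop Filter.tendsto_id
  have h2 : Filter.Tendsto (fun X : ℝ => (d + 3 * ε / 16) * (1 + (k : ℝ) / X) ^ r) Filter.atTop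
      (nhds ((d + 3 * ε / 16) * (1 + 0) ^ r)) := by
    refine Filter.Tendsto.const_mul _ (Filter.Tendsto.pow (Filter.Tendsto.const_add _ ?_) _)
    exact tendsto_const_nhds.div_atTop Filter.tendsto_id
  rw [add_zero, one_pow, mul_one] at h2
  have e1 := h1.eventually_le_const (show (0:ℝ) < ε / 64 by positivity)
  have e2 := h2.eventually_le_const (show d + 3 * ε / 16 < d + 7 * ε / 32 by linarith)
  have e3 := Filter.eventually_gt_atTop (0:ℝ)
  obtain ⟨X₀, h⟩ := Filter.eventually_atTop.1 (e1.and (e2.and e3))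
  refine ⟨X₀, fun X hX => ?_⟩
  obtain ⟨h1, h2, h3⟩ := h X hX
  refine ⟨?_, h1⟩
  have : X + k = X * (1 + (k : ℝ) / X) := by field_simp
  rw [this, mul_pow]
  calc _ = ((d + 3 * ε / 16) * (1 + (k : ℝ) / X) ^ r) * X ^ r := by ring
    _ ≤ _ := by gcongr

theorem asym2 (E : ℕ) (b : ℝ) (hb : 0 < b) :
    ∃ X₀ : ℝ, ∀ X ≥ X₀, X ^ E * Real.exp (-(b * X)) < 1 / 4 := by
  have h := (Real.tendsto_pow_mul_exp_neg_atTop_nhds_zero E).comp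
    (Filter.tendsto_id.const_mul_atTop hb)
  have e := h.eventually_lt_const (show (0:ℝ) < b ^ E / 4 by positivity)
  obtain ⟨X₀, h⟩ := Filter.eventually_atTop.1 e
  refine ⟨X₀, fun X hX => ?_⟩
  have := h X hX
  simp only [Function.comp, id] at this
  rw [mul_pow, mul_assoc] at this
  have hbE : 0 < b ^ E := by positivity
  have h4 : b ^ E * (X ^ E * Real.exp (-(b * X))) < b ^ E * (1 / 4) := by linarith
  exact lt_of_mul_lt_mul_left h4 hbE.le

theorem natcast_inj {M i i' : ℕ} (hi : i ∈ Finset.Icc 1 M) (hi' : i' ∈ Finset.Icc 1 M)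
    (h : (i : ZMod M) = (i' : ZMod M)) : i = i' := by
  rw [ZMod.natCast_eq_natCast_iff'] at h
  rw [mem_Icc] at hi hi'
  rcases Nat.lt_or_ge i M with h1 | h1 <;> rcases Nat.lt_or_ge i' M with h2 | h2
  · rwa [Nat.mod_eq_of_lt h1, Nat.mod_eq_of_lt h2] at h
  · have : i' = M := by omega
    rw [this, Nat.mod_self, Nat.mod_eq_of_lt h1] at h
    omega
  · have : i = M := by omega
    rw [this, Nat.mod_self, Nat.mod_eq_of_lt h2] at h
    omega
  · omega

theorem natcast_surj {M : ℕ} [NeZero M] (a : ZMod M) :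
    ∃ i ∈ Finset.Icc 1 M, (i : ZMod M) = a := by
  have hM : 0 < M := Nat.pos_of_ne_zero (NeZero.ne M)
  by_cases h : a = 0
  · exact ⟨M, mem_Icc.2 ⟨hM, le_rfl⟩, by simp [h]⟩
  · refine ⟨a.val, mem_Icc.2 ⟨?_, (ZMod.val_lt a).le⟩, by simp⟩
    have : a.val ≠ 0 := by rwa [Ne, ZMod.val_eq_zero]
    omega

theorem core {k : ℕ} (j : ℕ) (hjk : j < k) (G : HGraph k) (M N T D K c : ℕ) [NeZero M]
    (V' : Finset ℕ) (hV : V' ⊆ G.verts) (hVc : V'.card = N * M + c) (hc : c < M)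
    (hNT : N + 1 ≤ T) (hN : 0 < N) (hm : G.verts.card = T * M)
    (hcomp : (G.verts \ V').card ≤ k * M) (d ε : ℝ) (hε : 0 < ε)
    (hdeg : G.MinDegGe j ((d + ε / 4) * (G.verts.card : ℝ) ^ (k - j)))
    (hb : ((k : ℝ) + 1) / T ≤ ε / 64)
    (B : Finset (Finset ℕ)) (hB : ∀ b ∈ B, b ⊆ G.verts ∧ b.card = 2)
    (hD : ∀ v : ℕ, (B.filter fun b => v ∈ b).card ≤ D)
    (F : ℕ → Finset ℕ) (hF : ∀ i ∈ Finset.Icc 1 M, Disjoint V' (F i) ∧ (F i).card ≤ K)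
    (L : ℝ) (hL : 0 < L)
    (p1 : ((T : ℝ) * M) ^ j * M * Real.exp (-((ε / 64) ^ 2 * T / 2)) < 1 / 4)
    (p2 : (((K : ℝ) + T) * D) ^ 2 / M + 2 * T * (D : ℝ) ^ 2 / M ≤ 1 / 4)
    (p3 : ((K : ℝ) + T) * D ≤ L / 4) :
    ∃ U : ℕ → Finset ℕ,
      (∀ i ∈ Finset.Icc 1 M, ∀ i' ∈ Finset.Icc 1 M, i ≠ i' → Disjoint (U i) (U i')) ∧
      ((Finset.Icc 1 M).biUnion U = V') ∧
      (∀ i ∈ Finset.Icc 1 M, N ≤ (U i).card ∧ (U i).card ≤ N + 1) ∧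
      (∀ S ⊆ V', S.card = j → ∀ i ∈ Finset.Icc 1 M,
        (d + 7 * ε / 32) * (T : ℝ) ^ (k - j) ≤ (G.degIn S (U i) : ℝ)) ∧
      (∀ i ∈ Finset.Icc 1 M, ∃ u ∈ U i, ∀ b ∈ cand V' (F i) B, b ⊆ U i ∪ F i → u ∈ b) ∧
      (((Finset.Icc 1 M).filter fun i => ∃ b ∈ cand V' (F i) B, b ⊆ U i ∪ F i).card : ℝ) < L := by
  obtain ⟨g, p, hgp, hsurj⟩ := grouping V' N M c hVc hc
  have hM0 : 0 < M := Nat.pos_of_ne_zero (NeZero.ne M)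
  have hM : (0:ℝ) < M := by exact_mod_cast hM0
  have hcard : (Fintype.card (ZMod M) : ℕ) = M := ZMod.card M
  have hcardR : (Fintype.card (ZMod M) : ℝ) = M := by exact_mod_cast hcard
  set q : ℕ → ℕ → ZMod M := fun i v => (i : ZMod M) - p v with hq
  have hgq : ∀ i, Set.InjOn (fun v => (g v, q i v)) V' := by
    intro i v hv w hw h
    simp only [hq, Prod.mk.injEq, sub_right_inj] at h
    exact hgp hv hw (by simp [h.1, h.2])
  have hsq : ∀ i, ∀ x : Fin (N + 1), x.val < N → ∀ a, ∃ v ∈ V', g v = x ∧ q i v = a := by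
    intro i x hx a
    obtain ⟨v, hv, h1, h2⟩ := hsurj x hx ((i : ZMod M) - a)
    exact ⟨v, hv, h1, by simp [hq, h2]⟩
  have hB2 : ∀ b ∈ B, b.card = 2 := fun b hb => (hB b hb).2
  have hBc : (B.card : ℝ) ≤ T * M * D := by
    have := card_B_le B G.verts D hB hD
    rw [hm] at this
    exact_mod_cast this
  have hKD : (0:ℝ) ≤ K * D := by positivity
  set w : ℝ := (K + T) * D / M with hw
  have hww : (K:ℝ) * D * (1 / (Fintype.card (ZMod M) : ℝ)) +
      B.card * (1 / (Fintype.card (ZMod M) : ℝ)) ^ 2 ≤ w := by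
    rw [hcardR, hw]
    calc _ ≤ (K:ℝ) * D * (1 / (M : ℝ)) + (T * M * D) * (1 / (M : ℝ)) ^ 2 := by gcongr
      _ = _ := by field_simp
  -- event B
  have PB : gP (fun ω : Fin (N + 1) → ZMod M => ∃ x ∈ powersetCard j V' ×ˢ Finset.Icc 1 M,
      (G.degIn x.1 (cls V' g (q x.2) ω) : ℝ) < (d + 7 * ε / 32) * (T : ℝ) ^ (k - j)) < 1 / 4 := by
    refine lt_of_le_of_lt ((gP_union _ _).trans (sum_le_card_nsmul _ _
      (Real.exp (-((ε / 64) ^ 2 * T / 2))) ?_)) ?_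
    · rintro ⟨S, i⟩ hx
      simp only [mem_product, mem_powersetCard] at hx
      obtain ⟨⟨hS, hSj⟩, hi⟩ := hx
      have := partB G S V' hV (by omega) g (q i) (hgq i) T (by omega) (by rw [hcard, hm])
        (by rw [hcard]; exact hcomp) (by omega) hNT d ε hε
        (by rw [hSj]; exact hdeg S (hS.trans hV) hSj) hb
      rw [hSj] at this
      exact this
    · refine lt_of_le_of_lt ?_ p1
      rw [nsmul_eq_mul]
      gcongr
      rw [card_product, card_powersetCard]
      push_cast
      rw [Nat.card_Icc]
      have h1 : V'.card ≤ T * M := by rw [← hm]; exact card_le_card hV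
      have h2 : (V'.card.choose j : ℝ) ≤ ((T : ℝ) * M) ^ j := by
        have : V'.card.choose j ≤ (T * M) ^ j :=
          (Nat.choose_le_pow _ _).trans (Nat.pow_le_pow_left h1 _)
        exact_mod_cast this
      simp only [Nat.add_sub_cancel]
      gcongr
  -- event C
  have PC : gP (fun ω : Fin (N + 1) → ZMod M => ∃ i ∈ Finset.Icc 1 M,
      ¬ ∃ u ∈ cls V' g (q i) ω, ∀ b ∈ cand V' (F i) B, b ⊆ cls V' g (q i) ω ∪ F i → u ∈ b)
      ≤ 1 / 4 := by
    refine ((gP_union _ _).trans (sum_le_card_nsmul _ _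
      (w ^ 2 + (T * M * D) * (2 * D) * (1 / (M : ℝ)) ^ 3) ?_)).trans ?_
    · intro i hi
      refine (verybad_prob V' (F i) g (q i) (hgq i) (hF i hi).1 B D K hB2 hD (hF i hi).2 ?_).trans ?_
      · intro ω
        exact card_pos.1 (lt_of_lt_of_le hN (card_cls_ge (hsq i) ω))
      · rw [hcardR] at hww ⊢
        gcongr
    · refine le_trans (le_of_eq ?_) p2
      rw [nsmul_eq_mul, Nat.card_Icc, hw]
      simp only [Nat.add_sub_cancel]
      field_simp
  -- event D
  have PD : gP (fun ω : Fin (N + 1) → ZMod M => L ≤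
      (((Finset.Icc 1 M).filter fun i => ∃ b ∈ cand V' (F i) B,
        b ⊆ cls V' g (q i) ω ∪ F i).card : ℝ)) ≤ 1 / 4 := by
    refine (gP_markov _ (fun ω => by positivity) L hL).trans ?_
    have e1 : gE (fun ω : Fin (N + 1) → ZMod M =>
        (((Finset.Icc 1 M).filter fun i => ∃ b ∈ cand V' (F i) B,
        b ⊆ cls V' g (q i) ω ∪ F i).card : ℝ)) = ∑ i ∈ Finset.Icc 1 M,
        gP (fun ω : Fin (N + 1) → ZMod M => ∃ b ∈ cand V' (F i) B,
        b ⊆ cls V' g (q i) ω ∪ F i) := by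
      unfold gP
      rw [← gE_sum]
      congr 1
      funext ω
      rw [card_filter]
      push_cast
      congr!
    rw [e1, div_le_iff₀ hL]
    refine (sum_le_card_nsmul _ _ w ?_).trans ?_
    · intro i hi
      exact (bad_prob V' (F i) g (q i) (hgq i) (hF i hi).1 B D K hB2 hD (hF i hi).2).trans hww
    · rw [nsmul_eq_mul, Nat.card_Icc, hw]
      simp only [Nat.add_sub_cancel]
      have : (M:ℝ) * ((K + T) * D / M) = (K + T) * D := by field_simp
      rw [this]
      linarith
  have P2 := (gP_or _ _).trans (add_le_add PC PD)
  have P3 := lt_of_le_of_lt (gP_or _ _) (add_lt_add_of_lt_of_le PB P2)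
  obtain ⟨ω, hω⟩ := gP_exists_not _ (lt_trans P3 (by norm_num))
  push Not at hω
  obtain ⟨h1, h2, h3⟩ := hω
  refine ⟨fun i => cls V' g (q i) ω, ?_, ?_, ?_, ?_, ?_, ?_⟩
  · intro i hi i' hi' hne
    rw [disjoint_left]
    intro v hv hv'
    have e1 := (mem_cls.1 hv).2
    have e2 := (mem_cls.1 hv').2
    apply hne
    apply natcast_inj hi hi'
    have := e1.symm.trans e2
    simpa [hq] using this
  · ext v
    simp only [mem_biUnion, mem_cls]
    constructor
    · rintro ⟨i, _, h, _⟩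
      exact h
    · intro hv
      obtain ⟨i, hi, e⟩ := natcast_surj (p v + ω (g v))
      exact ⟨i, hi, hv, by simp [hq, e]⟩
  · intro i hi
    exact ⟨card_cls_ge (hsq i) ω, card_cls_le (hgq i) ω⟩
  · intro S hS hSj i hi
    exact h1 (S, i) (mem_product.2 ⟨mem_powersetCard.2 ⟨hS, hSj⟩, hi⟩)
  · exact h2
  · exact h3

set_option maxHeartbeats 2000000 in
/-- Claim: a partition of `V'` with properties (A)–(D) exists. -/
theorem good_partition_exists (j k : ℕ) (hj : 1 ≤ j) (hjk : j < k)
    (ε : ℝ) (hε : 0 < ε) :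
    ∃ β : ℝ, 0 < β ∧ β < 1 ∧ ∃ t₀ : ℕ, ∀ t : ℕ, t₀ ≤ t →
      ∀ G' : HGraph k, G'.verts.card = mOf k t →
        G'.MinDegGe j ((looseHamThreshold j k + ε / 4) * (mOf k t : ℝ) ^ (k - j)) →
        ∀ B : Finset (Finset ℕ), (∀ b ∈ B, b ⊆ G'.verts ∧ b.card = 2) →
          (∀ v : ℕ, (B.filter fun b => v ∈ b).card ≤ 2 * t * k ^ 2) →
          ∀ ua ub : ℕ → ℕ,
            (∀ i ∈ Finset.Icc 1 (mtOf k t), ua i ∈ G'.verts ∧ ub i ∈ G'.verts ∧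
              ua i ≠ ub i) →
            (∀ i ∈ Finset.Icc 1 (mtOf k t), ∀ i' ∈ Finset.Icc 1 (mtOf k t), i ≠ i' →
              Disjoint ({ua i, ub i} : Finset ℕ) {ua i', ub i'}) →
            ∀ W : ℕ → Finset ℕ, W 0 = ∅ → W (mtOf k t) = ∅ →
              (∀ i ∈ Finset.Icc 1 (mtOf k t - 1),
                W i ⊆ G'.verts \
                  ((Finset.Icc 1 (mtOf k t)).biUnion fun i' => {ua i', ub i'}) ∧
                (W i).card = k - 2) →
              (∀ i ∈ Finset.Icc 1 (mtOf k t - 1), ∀ i' ∈ Finset.Icc 1 (mtOf k t - 1),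
                i ≠ i' → Disjoint (W i) (W i')) →
              (∀ i ∈ Finset.Icc 1 (mtOf k t), ∀ b ∈ B,
                b ⊆ {ua i, ub i} ∪ W (i - 1) ∪ W i → b = ({ua i, ub i} : Finset ℕ)) →
              ∃ U : ℕ → Finset ℕ,
                (∀ i ∈ Finset.Icc 1 (mtOf k t), ∀ i' ∈ Finset.Icc 1 (mtOf k t), i ≠ i' →
                  Disjoint (U i) (U i')) ∧
                ((Finset.Icc 1 (mtOf k t)).biUnion U =
                  G'.verts \
                    (((Finset.Icc 1 (mtOf k t)).biUnion fun i' => {ua i', ub i'}) ∪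
                      (Finset.Icc 1 (mtOf k t - 1)).biUnion W)) ∧
                (∀ i ∈ Finset.Icc 1 (mtOf k t),
                  (((t - 1) * (k - 1) : ℕ) : ℝ) - β * t ≤ ((U i).card : ℝ) ∧
                  ((U i).card : ℝ) ≤ (((t - 1) * (k - 1) : ℕ) : ℝ) + β * t) ∧
                (∀ S ⊆ G'.verts \
                    (((Finset.Icc 1 (mtOf k t)).biUnion fun i' => {ua i', ub i'}) ∪
                      (Finset.Icc 1 (mtOf k t - 1)).biUnion W), S.card = j →
                  ∀ i ∈ Finset.Icc 1 (mtOf k t),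
                    (looseHamThreshold j k + 3 * ε / 16) *
                        (((U i ∪ {ua i, ub i} ∪ W (i - 1) ∪ W i).card : ℝ) ^ (k - j)) ≤
                      (G'.degIn S (U i ∪ {ua i, ub i} ∪ W (i - 1) ∪ W i) : ℝ)) ∧
                (∀ i ∈ Finset.Icc 1 (mtOf k t),
                  ∃ u ∈ U i, ∀ b ∈ B, b ⊆ U i ∪ {ua i, ub i} ∪ W (i - 1) ∪ W i →
                    b ≠ ({ua i, ub i} : Finset ℕ) → u ∈ b) ∧
                ((Finset.Icc 1 (mtOf k t)).filter fun i => ∃ b ∈ B,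
                    b ⊆ U i ∪ {ua i, ub i} ∪ W (i - 1) ∪ W i ∧
                    b ≠ ({ua i, ub i} : Finset ℕ)).card ≤ t ^ 3 * k ^ 3 := by
  set d := looseHamThreshold j k with hd
  have hk : 2 ≤ k := by omega
  obtain ⟨X₁, hX₁⟩ := asym1 k (k - j) d ε hε
  have hd0 : 0 ≤ d := Real.sInf_nonneg fun x hx => hx.1
  obtain ⟨X₂, hX₂⟩ := asym2 ((2 + 100 * k) * k + 100 * k) ((ε / 64) ^ 2 / 2) (by positivity)
  refine ⟨1 / 2, by norm_num, by norm_num, k + 100 + ⌈X₁⌉₊ + ⌈X₂⌉₊, ?_⟩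
  intro t ht G hG hdeg B hB hD ua ub hu hudis W hW0 hWM hW hWdis hBF
  have htk : k ≤ t := by omega
  have ht100 : 100 ≤ t := by omega
  have htX₁ : X₁ ≤ t := (Nat.le_ceil X₁).trans (by exact_mod_cast (by omega))
  have htX₂ : X₂ ≤ t := (Nat.le_ceil X₂).trans (by exact_mod_cast (by omega))
  set M := mtOf k t with hMdef
  set T := TOf k t with hTdef
  set m := mOf k t with hmdef
  have hmTM : m = T * M := rfl
  have hMt : M = t ^ (100 * k) := rfl
  have hTt : T = t * (k - 1) + 1 := rfl
  have hM13 : t ^ 13 ≤ M := by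
    rw [hMt]; exact Nat.pow_le_pow_right (by omega) (by omega)
  have htM : t ≤ M := le_trans (by
    calc t = t ^ 1 := (pow_one t).symm
      _ ≤ t ^ 13 := Nat.pow_le_pow_right (by omega) (by omega)) hM13
  have hM0 : 0 < M := by omega
  have : NeZero M := ⟨hM0.ne'⟩
  have htT : t ≤ T := by
    rw [hTt]
    have : t * 1 ≤ t * (k - 1) := Nat.mul_le_mul_left _ (by omega)
    omega
  have hTtk : T ≤ t * k := by
    rw [hTt]
    have : t * k = t * (k - 1) + t := by
      conv_lhs => rw [show k = (k - 1) + 1 by omega]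
      ring
    omega
  set R := (Finset.Icc 1 M).biUnion fun i' => ({ua i', ub i'} : Finset ℕ) with hR
  set WW := (Finset.Icc 1 (M - 1)).biUnion W with hWW
  set V' := G.verts \ (R ∪ WW) with hV'
  set F : ℕ → Finset ℕ := fun i => {ua i, ub i} ∪ W (i - 1) ∪ W i with hFdef
  have hRc : R.card = M * 2 := by
    rw [hR, card_biUnion (fun i hi i' hi' hne => hudis i hi i' hi' hne)]
    rw [sum_congr rfl (fun i hi => card_pair (hu i hi).2.2)]
    simp
  have hWWc : WW.card = (M - 1) * (k - 2) := by
    rw [hWW, card_biUnion (fun i hi i' hi' hne => hWdis i hi i' hi' hne)]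
    rw [sum_congr rfl (fun i hi => (hW i hi).2)]
    simp
  have hRV : R ⊆ G.verts := by
    intro v hv
    simp only [hR, mem_biUnion, mem_insert, mem_singleton] at hv
    obtain ⟨i, hi, rfl | rfl⟩ := hv
    · exact (hu i hi).1
    · exact (hu i hi).2.1
  have hWWV : WW ⊆ G.verts \ R := by
    intro v hv
    rw [hWW, mem_biUnion] at hv
    obtain ⟨i, hi, hv⟩ := hv
    exact (hW i hi).1 hv
  have hRWd : Disjoint R WW := by
    rw [disjoint_right]
    intro v hv
    exact (mem_sdiff.1 (hWWV hv)).2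
  have hRWs : R ∪ WW ⊆ G.verts := union_subset hRV (hWWV.trans sdiff_subset)
  have hRWc : (R ∪ WW).card = M * 2 + (M - 1) * (k - 2) := by
    rw [card_union_of_disjoint hRWd, hRc, hWWc]
  have hV'c : V'.card = ((t - 1) * (k - 1)) * M + (k - 2) := by
    rw [hV', card_sdiff_of_subset hRWs, hRWc, hG, hmTM, hTt]
    obtain ⟨l, hl⟩ : ∃ l, k = l + 2 := ⟨k - 2, by omega⟩
    obtain ⟨M', hM'⟩ : ∃ M', M = M' + 1 := ⟨M - 1, by omega⟩
    obtain ⟨t', ht'⟩ : ∃ t', t = t' + 1 := ⟨t - 1, by omega⟩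
    rw [hM', ht', hl]
    simp only [Nat.add_sub_cancel, show l + 2 - 1 = l + 1 by omega]
    apply Nat.sub_eq_of_eq_add
    ring
  have hcomp : (G.verts \ V').card ≤ k * M := by
    rw [hV', Finset.sdiff_sdiff_eq_self hRWs, hRWc]
    calc M * 2 + (M - 1) * (k - 2) ≤ M * 2 + M * (k - 2) := by gcongr; omega
      _ = k * M := by
        rw [← mul_add, mul_comm]; congr 1; omega
  have hWsub : ∀ i ≤ M, W i ⊆ R ∪ WW ∧ (W i).card ≤ k - 2 := by
    intro i hi
    rcases Nat.eq_zero_or_pos i with rfl | h0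
    · rw [hW0]; simp
    · rcases Nat.lt_or_ge i M with h1 | h1
      · have hi' : i ∈ Finset.Icc 1 (M - 1) := mem_Icc.2 ⟨h0, by omega⟩
        refine ⟨?_, (hW i hi').2.le⟩
        exact (subset_biUnion_of_mem W hi').trans subset_union_right
      · have : i = M := by omega
        rw [this, hWM]; simp
  have hF : ∀ i ∈ Finset.Icc 1 M, Disjoint V' (F i) ∧ (F i).card ≤ 2 * k - 2 := by
    intro i hi
    have hi' := mem_Icc.1 hi
    have w1 := hWsub (i - 1) (by omega)
    have w2 := hWsub i hi'.2
    constructor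
    · have : F i ⊆ R ∪ WW := by
        refine union_subset (union_subset ?_ w1.1) w2.1
        refine subset_trans ?_ subset_union_left
        exact subset_biUnion_of_mem (fun i' => ({ua i', ub i'} : Finset ℕ)) hi
      exact disjoint_sdiff_self_left.mono_right this
    · refine (card_union_le _ _).trans ?_
      have h1 := card_union_le ({ua i, ub i} : Finset ℕ) (W (i - 1))
      have h2 : ({ua i, ub i} : Finset ℕ).card ≤ 2 := card_le_two
      omega
  -- numeric facts
  have htR : (100:ℝ) ≤ t := by exact_mod_cast ht100
  have hkR : (2:ℝ) ≤ k := by exact_mod_cast hk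
  have hktR : (k:ℝ) ≤ t := by exact_mod_cast htk
  have htTR : (t:ℝ) ≤ T := by exact_mod_cast htT
  have hTtkR : (T:ℝ) ≤ t * k := by exact_mod_cast hTtk
  have hMR : (0:ℝ) < M := by exact_mod_cast hM0
  have hM13R : (t:ℝ) ^ 13 ≤ M := by exact_mod_cast hM13
  obtain ⟨a1, a2⟩ := hX₁ T (htX₁.trans htTR)
  have hKT : (((2 * k - 2 : ℕ) : ℝ) + T) * ((2 * t * k ^ 2 : ℕ) : ℝ) ≤ (t:ℝ) ^ 3 * k ^ 3 / 4 := by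
    have e1 : ((2 * k - 2 : ℕ) : ℝ) ≤ 2 * k := by
      have : 2 * k - 2 ≤ 2 * k := by omega
      exact_mod_cast this
    calc _ ≤ (2 * (k:ℝ) + t * k) * ((2 * t * k ^ 2 : ℕ) : ℝ) := by gcongr
      _ = ((2 + t) * 2) * (t * (k:ℝ) ^ 3) := by push_cast; ring
      _ ≤ ((t:ℝ) ^ 2 / 4) * (t * (k:ℝ) ^ 3) := by gcongr; nlinarith
      _ = _ := by ring
  have p2 : ((((2 * k - 2 : ℕ) : ℝ) + T) * ((2 * t * k ^ 2 : ℕ) : ℝ)) ^ 2 / M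
      + 2 * T * ((2 * t * k ^ 2 : ℕ) : ℝ) ^ 2 / M ≤ 1 / 4 := by
    rw [← add_div, div_le_iff₀ hMR]
    have e1 : (t:ℝ) ^ 3 * k ^ 3 / 4 ≤ (t:ℝ) ^ 6 / 4 := by
      calc _ ≤ (t:ℝ) ^ 3 * t ^ 3 / 4 := by gcongr
        _ = _ := by ring
    have e2 : 2 * (T:ℝ) * ((2 * t * k ^ 2 : ℕ) : ℝ) ^ 2 ≤ 8 * (t:ℝ) ^ 8 := by
      push_cast
      calc _ ≤ 2 * ((t:ℝ) * t) * (2 * t * t ^ 2) ^ 2 := by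
            gcongr
            exact hTtkR.trans (by gcongr)
        _ = _ := by ring
    have e3 : 8 * (t:ℝ) ^ 8 ≤ 8 * (t:ℝ) ^ 12 := by
      gcongr
      · linarith
      · norm_num
    calc _ ≤ ((t:ℝ) ^ 6 / 4) ^ 2 + 8 * (t:ℝ) ^ 12 :=
          add_le_add (pow_le_pow_left₀ (by positivity) (hKT.trans e1) 2) (e2.trans e3)
      _ = (1 / 16 + 8) * (t:ℝ) ^ 12 := by ring
      _ ≤ (t / 4) * (t:ℝ) ^ 12 := by gcongr; linarith
      _ = 1 / 4 * (t:ℝ) ^ 13 := by ring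
      _ ≤ _ := by gcongr
  have p1 : ((T : ℝ) * M) ^ j * M * Real.exp (-((ε / 64) ^ 2 * T / 2)) < 1 / 4 := by
    refine lt_of_le_of_lt ?_ (hX₂ t htX₂)
    have hMtR : (M:ℝ) = (t:ℝ) ^ (100 * k) := by rw [hMt]; push_cast; rfl
    have e1 : (T:ℝ) * M ≤ (t:ℝ) ^ (2 + 100 * k) := by
      rw [pow_add, hMtR]
      gcongr
      calc (T:ℝ) ≤ t * k := hTtkR
        _ ≤ t * t := by gcongr
        _ = _ := by ring
    have e2 : ((T : ℝ) * M) ^ j * M ≤ (t:ℝ) ^ ((2 + 100 * k) * k + 100 * k) := by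
      rw [pow_add, pow_mul, hMtR.symm]
      gcongr
      calc ((T : ℝ) * M) ^ j ≤ ((t:ℝ) ^ (2 + 100 * k)) ^ j := by gcongr
        _ ≤ _ := by
          apply pow_le_pow_right₀ _ hjk.le
          exact one_le_pow₀ (by linarith)
    apply mul_le_mul e2 _ (Real.exp_pos _).le (by positivity)
    apply Real.exp_le_exp.2
    have : (ε / 64) ^ 2 / 2 * t ≤ (ε / 64) ^ 2 / 2 * T := by gcongr
    linarith
  have hNT : (t - 1) * (k - 1) + k = T := by
    rw [hTt]
    obtain ⟨l, hl⟩ : ∃ l, k = l + 2 := ⟨k - 2, by omega⟩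
    obtain ⟨t', ht'⟩ : ∃ t', t = t' + 1 := ⟨t - 1, by omega⟩
    rw [ht', hl]
    simp only [Nat.add_sub_cancel, show l + 2 - 1 = l + 1 by omega]
    ring
  obtain ⟨U, u1, u2, u3, u4, u5, u6⟩ := core j hjk G M ((t - 1) * (k - 1)) T (2 * t * k ^ 2)
    (2 * k - 2) (k - 2) V' sdiff_subset hV'c (by omega) (by omega)
    (Nat.mul_pos (by omega) (by omega)) (hG.trans hmTM) hcomp d ε hε (by rw [hG]; exact hdeg)
    a2 B hB hD F hF ((t:ℝ) ^ 3 * k ^ 3) (by positivity) p1 p2 hKT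
  have hUF : ∀ i, U i ∪ {ua i, ub i} ∪ W (i - 1) ∪ W i = U i ∪ F i := by
    intro i
    simp only [hFdef, union_assoc]
  have hcand : ∀ i ∈ Finset.Icc 1 M, ∀ b ∈ B, b ⊆ U i ∪ F i →
      b ≠ ({ua i, ub i} : Finset ℕ) → b ∈ cand V' (F i) B := by
    intro i hi b hb hbs hne
    have hUV : U i ⊆ V' := by
      rw [← u2]; exact subset_biUnion_of_mem U hi
    refine mem_filter.2 ⟨hb, hbs.trans (union_subset_union_left hUV), ?_⟩
    by_contra hc
    rw [not_nonempty_iff_eq_empty] at hc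
    apply hne
    apply hBF i hi b hb
    intro v hv
    rcases mem_union.1 (hbs hv) with h | h
    · have : v ∈ b ∩ V' := mem_inter.2 ⟨hv, hUV h⟩
      rw [hc] at this
      simp at this
    · exact h
  refine ⟨U, u1, u2, ?_, ?_, ?_, ?_⟩
  · intro i hi
    obtain ⟨h1, h2⟩ := u3 i hi
    have h1' : (((t - 1) * (k - 1) : ℕ) : ℝ) ≤ (U i).card := by exact_mod_cast h1
    have h2' : ((U i).card : ℝ) ≤ (((t - 1) * (k - 1) : ℕ) : ℝ) + 1 := by exact_mod_cast h2
    constructor <;> linarith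
  · intro S hS hSj i hi
    simp only [hUF]
    have h1 := u4 S hS hSj i hi
    have h2 : ((U i ∪ F i).card : ℝ) ≤ T + k := by
      have := card_union_le (U i) (F i)
      have h3 := (u3 i hi).2
      have h4 := (hF i hi).2
      have : (U i ∪ F i).card ≤ T + k := by omega
      exact_mod_cast this
    calc _ ≤ (d + 3 * ε / 16) * ((T:ℝ) + k) ^ (k - j) := by gcongr
      _ ≤ _ := a1
      _ ≤ _ := h1
      _ ≤ _ := by exact_mod_cast degIn_mono G S subset_union_left
  · intro i hi
    simp only [hUF]
    obtain ⟨u, hu, h⟩ := u5 i hi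
    exact ⟨u, hu, fun b hb hbs hne => h b (hcand i hi b hb hbs hne) hbs⟩
  · simp only [hUF]
    have h7 : ((Finset.Icc 1 M).filter fun i => ∃ b ∈ cand V' (F i) B, b ⊆ U i ∪ F i).card
        < t ^ 3 * k ^ 3 := by exact_mod_cast u6
    refine le_trans (card_le_card ?_) h7.le
    intro i hi
    rw [mem_filter] at hi ⊢
    obtain ⟨hi, b, hb, hbs, hne⟩ := hi
    exact ⟨hi, b, hcand i hi b hb hbs hne, hbs⟩


end
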